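/- arXiv:1006.3430 — 4 statements merged into one kernel-verified Lean document; each statement's English description precedes it below -/
import Mathlib

section
/- Let P be the transition matrix of an irreducible, time-reversible finite Markov chain (a weighted random walk on a finite connected graph) with stationary distribution π, and let H(u,v) denote the expected hitting time of state v starting from state u. Then for all states i, j, v, the series Σ_{t=0}^∞ (P^t_{i,v} − P^t_{j,v}) — taken as a Cesàro summation in case the chain is periodic — equals π_v · (H(j,v) − H(i,v)). -/
/-- `rwSurvive P v t u` is the probability that the Markov chain with transition
probabilities `P`, started at `u`, has not visited `v` during the first `t` steps. -/
noncomputable def rwSurvive {V : Type*} [Fintype V] [DecidableEq V]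
    (P : V → V → ℝ) (v : V) : ℕ → V → ℝ
  | 0, u => if u = v then 0 else 1
  | t + 1, u => if u = v then 0 else ∑ w, P u w * rwSurvive P v t w

/-- `rwHit P u v` is the expected hitting time of `v` starting from `u`, defined via
`E[T] = ∑_{t ≥ 0} Pr[T > t]`. -/
noncomputable def rwHit {V : Type*} [Fintype V] [DecidableEq V]
    (P : V → V → ℝ) (u v : V) : ℝ :=
  ∑' t : ℕ, rwSurvive P v t u

/-- `rwPow P t` is the `t`-step transition probability "matrix" of `P`. -/
noncomputable def rwPow {V : Type*} [Fintype V] [DecidableEq V]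
    (P : V → V → ℝ) : ℕ → V → V → ℝ
  | 0 => fun i k => if i = k then 1 else 0
  | t + 1 => fun i k => ∑ w, P i w * rwPow P t w k

open Filter

section CesaroHelpers

variable {V : Type*} [Fintype V] [DecidableEq V]

lemma rwSurvive_nonneg_aux (P : V → V → ℝ) (hP0 : ∀ u w, 0 ≤ P u w) (v : V) (t : ℕ) :
    ∀ u, 0 ≤ rwSurvive P v t u := by
  induction t with
  | zero => intro u; simp only [rwSurvive]; split_ifs <;> norm_num
  | succ t ih =>
    intro u
    simp only [rwSurvive]
    split_ifs
    · exact le_rfl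
    · exact Finset.sum_nonneg fun w _ => mul_nonneg (hP0 u w) (ih w)

lemma rwSurvive_sum_le_aux (P : V → V → ℝ) (hP0 : ∀ u w, 0 ≤ P u w) (v : V)
    (g : V → ℝ) (hg0 : ∀ u, 0 ≤ g u) (hg : ∀ u, u ≠ v → 1 + ∑ w, P u w * g w ≤ g u) (T : ℕ) :
    ∀ u, ∑ t ∈ Finset.range T, rwSurvive P v t u ≤ g u := by
  induction T with
  | zero => intro u; simpa using hg0 u
  | succ T ih =>
    intro u
    rw [Finset.sum_range_succ']
    by_cases h : u = v
    · simp [rwSurvive, h, hg0]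
    · simp only [rwSurvive, h, if_false]
      rw [Finset.sum_comm]
      simp only [← Finset.mul_sum]
      have := Finset.sum_le_sum (s := Finset.univ)
        fun w (_ : w ∈ Finset.univ) => mul_le_mul_of_nonneg_left (ih w) (hP0 u w)
      linarith [hg u h]

lemma rwSurvive_summable_aux (P : V → V → ℝ) (hP0 : ∀ u w, 0 ≤ P u w) (v : V)
    (g : V → ℝ) (hg0 : ∀ u, 0 ≤ g u) (hg : ∀ u, u ≠ v → 1 + ∑ w, P u w * g w ≤ g u) (u : V) :
    Summable fun t => rwSurvive P v t u :=
  summable_of_sum_range_le (fun t => rwSurvive_nonneg_aux P hP0 v t u)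
    (fun T => rwSurvive_sum_le_aux P hP0 v g hg0 hg T u)

lemma rwHit_self_aux (P : V → V → ℝ) (v : V) : rwHit P v v = 0 := by
  have : ∀ t, rwSurvive P v t v = 0 := by
    intro t; cases t <;> simp [rwSurvive]
  simp [rwHit, this]

lemma rwHit_step_aux (P : V → V → ℝ) (v : V)
    (hs : ∀ u, Summable fun t => rwSurvive P v t u) (u : V) (hu : u ≠ v) :
    rwHit P u v = 1 + ∑ w, P u w * rwHit P w v := by
  have h1 := (hs u).tsum_eq_zero_add
  rw [rwHit, h1]
  simp only [rwSurvive, hu, if_false]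
  congr 1
  rw [Summable.tsum_finsetSum (fun w _ => (hs w).mul_left _)]
  simp only [tsum_mul_left, rwHit]

lemma rwPow_nonneg_aux (P : V → V → ℝ) (hP0 : ∀ u w, 0 ≤ P u w) (t : ℕ) :
    ∀ u w, 0 ≤ rwPow P t u w := by
  induction t with
  | zero => intro u w; simp only [rwPow]; split_ifs <;> norm_num
  | succ t ih =>
    intro u w
    simp only [rwPow]
    exact Finset.sum_nonneg fun x _ => mul_nonneg (hP0 u x) (ih x w)

lemma rwPow_row_sum_aux (P : V → V → ℝ) (hP1 : ∀ u, ∑ w, P u w = 1) (t : ℕ) :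
    ∀ u, ∑ w, rwPow P t u w = 1 := by
  induction t with
  | zero => intro u; simp [rwPow]
  | succ t ih =>
    intro u
    simp only [rwPow]
    rw [Finset.sum_comm]
    simp only [← Finset.mul_sum, ih, mul_one, hP1]

/-- Potential identity: telescoped partial sums of the powers. -/
lemma rwPow_sum_aux (P : V → V → ℝ) (hP1 : ∀ u, ∑ w, P u w = 1) (v : V) (q : ℝ) (h : V → ℝ)
    (hh : ∀ u, (if u = v then (1 : ℝ) else 0) = q * (1 - h u + ∑ w, P u w * h w)) (T : ℕ) :
    ∀ u, ∑ t ∈ Finset.range T, rwPow P t u v = q * (T - h u + ∑ w, rwPow P T u w * h w) := by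
  induction T with
  | zero => intro u; simp [rwPow]
  | succ T ih =>
    intro u
    rw [Finset.sum_range_succ']
    simp only [rwPow]
    rw [Finset.sum_comm]
    simp only [← Finset.mul_sum, ih]
    rw [hh u]
    have e1 : ∑ x, P u x * (q * (T - h x + ∑ w, rwPow P T x w * h w))
        = q * (T * ∑ x, P u x - ∑ x, P u x * h x
            + ∑ x, P u x * ∑ w, rwPow P T x w * h w) := by
      rw [Finset.mul_sum, ← Finset.sum_sub_distrib, ← Finset.sum_add_distrib, Finset.mul_sum]
      exact Finset.sum_congr rfl fun x _ => by ring
    have e2 : ∑ w, (∑ x, P u x * rwPow P T x w) * h w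
        = ∑ x, P u x * ∑ w, rwPow P T x w * h w := by
      simp only [Finset.sum_mul, Finset.mul_sum]
      rw [Finset.sum_comm]
      exact Finset.sum_congr rfl fun x _ => Finset.sum_congr rfl fun w _ => by ring
    rw [e1, e2, hP1]
    push_cast
    ring

/-- Averages of the differences of powers vanish. -/
lemma rwPow_avg_aux (P : V → V → ℝ) (hP0 : ∀ u w, 0 ≤ P u w) (hP1 : ∀ u, ∑ w, P u w = 1)
    (v : V) (q : ℝ) (h : V → ℝ)
    (hh : ∀ u, (if u = v then (1 : ℝ) else 0) = q * (1 - h u + ∑ w, P u w * h w)) (i j : V) :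
    Tendsto (fun T : ℕ => (1 / (T : ℝ)) *
      ∑ t ∈ Finset.range T, (rwPow P (t + 1) i v - rwPow P (t + 1) j v)) atTop (nhds 0) := by
  obtain ⟨M, hM⟩ : ∃ M, ∀ u, |h u| ≤ M :=
    ⟨∑ u, |h u|, fun u => Finset.single_le_sum (f := fun u => |h u|)
      (fun w _ => abs_nonneg _) (Finset.mem_univ u)⟩
  have hB : ∀ T u, |∑ w, rwPow P T u w * h w| ≤ M := by
    intro T u
    calc |∑ w, rwPow P T u w * h w| ≤ ∑ w, |rwPow P T u w * h w| :=
          Finset.abs_sum_le_sum_abs _ _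
      _ ≤ ∑ w, rwPow P T u w * M := by
          refine Finset.sum_le_sum fun w _ => ?_
          rw [abs_mul, abs_of_nonneg (rwPow_nonneg_aux P hP0 T u w)]
          exact mul_le_mul_of_nonneg_left (hM w) (rwPow_nonneg_aux P hP0 T u w)
      _ = M := by rw [← Finset.sum_mul, rwPow_row_sum_aux P hP1, one_mul]
  have hS : ∀ T : ℕ, |∑ t ∈ Finset.range T, (rwPow P (t + 1) i v - rwPow P (t + 1) j v)|
      ≤ |q| * (4 * M) + 2 := by
    intro T
    have e : ∑ t ∈ Finset.range T, (rwPow P (t + 1) i v - rwPow P (t + 1) j v)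
        = q * (h j - h i + ∑ w, rwPow P (T + 1) i w * h w - ∑ w, rwPow P (T + 1) j w * h w)
          - (rwPow P 0 i v - rwPow P 0 j v) := by
      have a := rwPow_sum_aux P hP1 v q h hh (T + 1) i
      have b := rwPow_sum_aux P hP1 v q h hh (T + 1) j
      rw [Finset.sum_range_succ'] at a b
      rw [Finset.sum_sub_distrib]
      linarith
    rw [e]
    have h0 : |rwPow P 0 i v - rwPow P 0 j v| ≤ 2 := by
      simp only [rwPow]
      split_ifs <;> norm_num
    refine (abs_sub _ _).trans (add_le_add ?_ h0)
    rw [abs_mul]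
    refine mul_le_mul_of_nonneg_left ?_ (abs_nonneg q)
    have a1 := abs_le.1 (hM i)
    have a2 := abs_le.1 (hM j)
    have a3 := abs_le.1 (hB (T + 1) i)
    have a4 := abs_le.1 (hB (T + 1) j)
    rw [abs_le]
    constructor <;> linarith
  have hz : Tendsto (fun T : ℕ => (1 / (T : ℝ)) * (|q| * (4 * M) + 2)) atTop (nhds 0) := by
    simpa using (tendsto_one_div_atTop_nhds_zero_nat (𝕜 := ℝ)).mul_const (|q| * (4 * M) + 2)
  refine squeeze_zero_norm (fun T => ?_) hz
  rw [Real.norm_eq_abs, abs_mul, abs_of_nonneg (by positivity : (0 : ℝ) ≤ 1 / (T : ℝ))]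
  exact mul_le_mul_of_nonneg_left (hS T) (by positivity)

lemma cesaro_core_aux (P : V → V → ℝ) (hP0 : ∀ u w, 0 ≤ P u w) (hP1 : ∀ u, ∑ w, P u w = 1)
    (q : V → ℝ) (h : V → V → ℝ)
    (hh : ∀ v u, (if u = v then (1 : ℝ) else 0) = q v * (1 - h u v + ∑ w, P u w * h w v))
    (i j v : V) :
    Tendsto
      (fun T : ℕ => (1 / (T : ℝ)) *
        ∑ T' ∈ Finset.range T, ∑ t ∈ Finset.range (T' + 1),
          (rwPow P t i v - rwPow P t j v))
      atTop (nhds (q v * (h j v - h i v))) := by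
  have h1 : Tendsto (fun T : ℕ => ∑ w, ((1 / (T : ℝ)) *
      ∑ t ∈ Finset.range T, (rwPow P (t + 1) i w - rwPow P (t + 1) j w)) * h w v) atTop
      (nhds 0) := by
    have := tendsto_finsetSum (Finset.univ : Finset V) fun w _ =>
      (rwPow_avg_aux P hP0 hP1 w (q w) (fun u => h u w) (hh w) i j).mul_const (h w v)
    simpa using this
  have h2 : Tendsto (fun T : ℕ => q v * (h j v - h i v) + q v * ∑ w, ((1 / (T : ℝ)) *
      ∑ t ∈ Finset.range T, (rwPow P (t + 1) i w - rwPow P (t + 1) j w)) * h w v) atTop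
      (nhds (q v * (h j v - h i v))) := by
    simpa using (h1.const_mul (q v)).const_add (q v * (h j v - h i v))
  refine h2.congr' ?_
  filter_upwards [eventually_gt_atTop 0] with T hT
  have hT' : (T : ℝ) ≠ 0 := by positivity
  have e : ∀ T' : ℕ, ∑ t ∈ Finset.range (T' + 1), (rwPow P t i v - rwPow P t j v)
      = q v * (h j v - h i v) +
        q v * ∑ w, (rwPow P (T' + 1) i w - rwPow P (T' + 1) j w) * h w v := by
    intro T'
    rw [Finset.sum_sub_distrib, rwPow_sum_aux P hP1 v (q v) (fun u => h u v) (hh v),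
      rwPow_sum_aux P hP1 v (q v) (fun u => h u v) (hh v)]
    simp only [sub_mul, Finset.sum_sub_distrib]
    ring
  simp only [e]
  have e3 : ∑ T' ∈ Finset.range T,
        q v * ∑ w, (rwPow P (T' + 1) i w - rwPow P (T' + 1) j w) * h w v
      = q v * ∑ w, (∑ t ∈ Finset.range T, (rwPow P (t + 1) i w - rwPow P (t + 1) j w))
          * h w v := by
    rw [← Finset.mul_sum, Finset.sum_comm]
    simp only [← Finset.sum_mul]
  rw [Finset.sum_add_distrib, e3]
  simp only [Finset.sum_const, Finset.card_range, nsmul_eq_mul]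
  rw [mul_add, ← mul_assoc, one_div_mul_cancel hT', one_mul]
  congr 1
  simp only [mul_assoc]
  rw [← Finset.mul_sum]
  ring

end CesaroHelpers

/-- For an irreducible time-reversible finite Markov chain (a weighted
random walk on a finite connected graph) with transition probabilities `P` and stationary
distribution `π`, and expected hitting times `rwHit P`, the series
`∑_{t=0}^∞ (P^t_{i,v} − P^t_{j,v})`, taken in the sense of Cesàro summation of its partial
sums, equals `π_v · (H(j,v) − H(i,v))`. -/
theorem cesaro_sum_eq_stationary_mul_hitting_diff
    {V : Type*} [Fintype V] [DecidableEq V] [Nonempty V]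
    (c : V → V → ℕ) (hsymm : ∀ u v, c u v = c v u)
    (G : SimpleGraph V)
    (hadj : ∀ u v, G.Adj u v ↔ u ≠ v ∧ 0 < c u v)
    (hconn : G.Connected)
    (P : V → V → ℝ)
    (hP : ∀ u v, P u v = (c u v : ℝ) / ∑ w, (c u w : ℝ))
    (π : V → ℝ)
    (hπ : ∀ u, π u = (∑ w, (c u w : ℝ)) / ∑ x, ∑ w, (c x w : ℝ))
    (i j v : V) :
    Tendsto
      (fun T : ℕ => (1 / (T : ℝ)) *
        ∑ T' ∈ Finset.range T, ∑ t ∈ Finset.range (T' + 1),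
          (rwPow P t i v - rwPow P t j v))
      atTop (nhds (π v * (rwHit P j v - rwHit P i v))) := by
  by_cases hij : i = j
  · subst hij; simp
  have hnt : Nontrivial V := ⟨i, j, hij⟩
  set d : V → ℝ := fun u => ∑ w, (c u w : ℝ) with hd
  set C : ℝ := ∑ x, d x with hC
  have hd0 : ∀ u, 0 < d u := by
    intro u
    obtain ⟨w, hw⟩ := hconn.preconnected.exists_adj_of_nontrivial u
    refine Finset.sum_pos' (fun _ _ => by positivity) ⟨w, Finset.mem_univ _, ?_⟩
    exact_mod_cast ((hadj u w).1 hw).2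
  have hdC : ∀ u, d u ≤ C := fun u =>
    Finset.single_le_sum (fun w _ => (hd0 w).le) (Finset.mem_univ u)
  have hC0 : 0 < C := (hd0 i).trans_le (hdC i)
  have hP0 : ∀ u w, 0 ≤ P u w := fun u w => by rw [hP]; positivity
  have hP1 : ∀ u, ∑ w, P u w = 1 := by
    intro u
    simp only [hP, ← Finset.sum_div]
    exact div_self (hd0 u).ne'
  have hstat : ∀ w, ∑ u, d u * P u w = d w := by
    intro w
    refine Finset.sum_congr rfl fun u _ => ?_
    rw [hP, hsymm w u]
    exact mul_div_cancel₀ _ (hd0 u).ne'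
  -- lower bound on the transition probabilities along edges
  have hPadj : ∀ u w, G.Adj u w → 1 / C ≤ P u w := by
    intro u w huw
    rw [hP]
    have : (1 : ℝ) ≤ c u w := by exact_mod_cast ((hadj u w).1 huw).2
    exact div_le_div₀ (by positivity) this (hd0 u) (hdC u)
  have hC1 : 1 ≤ C := by
    obtain ⟨w, hw⟩ := hconn.preconnected.exists_adj_of_nontrivial i
    have h1 : (1 : ℝ) ≤ c i w := by exact_mod_cast ((hadj i w).1 hw).2
    have h2 : (c i w : ℝ) ≤ d i :=
      Finset.single_le_sum (f := fun w => (c i w : ℝ)) (fun w _ => by positivity)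
        (Finset.mem_univ w)
    linarith [hdC i]
  have hsummable : ∀ v u, Summable fun t => rwSurvive P v t u := by
    intro v
    obtain ⟨ε, hε⟩ : ∃ ε : ℝ, ε = 1 / (2 * C) := ⟨_, rfl⟩
    have hε0 : 0 < ε := by rw [hε]; positivity
    have hε1 : ε ≤ 1 := by
      rw [hε, div_le_one (by positivity)]; linarith
    have h2ε : 1 / C = 2 * ε := by rw [hε]; field_simp
    obtain ⟨N, hN⟩ : ∃ N : ℕ, ∀ u, G.dist u v ≤ N :=
      ⟨∑ u, G.dist u v, fun u => Finset.single_le_sum (f := fun u => G.dist u v)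
        (fun w _ => Nat.zero_le _) (Finset.mem_univ u)⟩
    refine rwSurvive_summable_aux P hP0 v (fun u => (1 - ε ^ G.dist u v) / ε ^ N) ?_ ?_
    · intro u
      exact div_nonneg (sub_nonneg.2 (pow_le_one₀ hε0.le hε1)) (by positivity)
    · intro u hu
      obtain ⟨p, hp⟩ := hconn.exists_walk_length_eq_dist u v
      obtain ⟨w0, hw0, hdist⟩ : ∃ w0, G.Adj u w0 ∧ G.dist w0 v + 1 ≤ G.dist u v := by
        cases p with
        | nil => exact absurd rfl hu
        | cons hadj' p' =>
          refine ⟨_, hadj', ?_⟩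
          rw [← hp, SimpleGraph.Walk.length_cons]
          exact Nat.succ_le_succ (SimpleGraph.dist_le p')
      have hsum : ∑ w, P u w * ((1 - ε ^ G.dist w v) / ε ^ N)
          = (1 - ∑ w, P u w * ε ^ G.dist w v) / ε ^ N := by
        have e0 : 1 - ∑ w, P u w * ε ^ G.dist w v = ∑ w, (P u w - P u w * ε ^ G.dist w v) := by
          rw [Finset.sum_sub_distrib, hP1 u]
        rw [e0, Finset.sum_div]
        exact Finset.sum_congr rfl fun w _ => by ring
      have hlow : 2 * ε ^ G.dist u v ≤ ∑ w, P u w * ε ^ G.dist w v := by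
        calc 2 * ε ^ G.dist u v ≤ 2 * ε ^ (G.dist w0 v + 1) :=
              mul_le_mul_of_nonneg_left (pow_le_pow_of_le_one hε0.le hε1 hdist) (by norm_num)
          _ = (1 / C) * ε ^ G.dist w0 v := by rw [h2ε]; ring
          _ ≤ P u w0 * ε ^ G.dist w0 v :=
              mul_le_mul_of_nonneg_right (hPadj u w0 hw0) (by positivity)
          _ ≤ _ := Finset.single_le_sum (f := fun w => P u w * ε ^ G.dist w v)
              (fun w _ => mul_nonneg (hP0 u w) (by positivity)) (Finset.mem_univ w0)
      have hNu : ε ^ N ≤ ε ^ G.dist u v := pow_le_pow_of_le_one hε0.le hε1 (hN u)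
      have hεN : 0 < ε ^ N := by positivity
      simp only [hsum]
      rw [le_div_iff₀ hεN, add_mul, div_mul_cancel₀ _ hεN.ne']
      linarith
  refine cesaro_core_aux P hP0 hP1 π (fun u w => rwHit P u w) ?_ i j v
  intro v u
  have hstep := rwHit_step_aux P v (hsummable v)
  -- the expected return time
  have hret : d v * (1 + ∑ w, P v w * rwHit P w v) = C := by
    have e1 : ∑ u, d u * ∑ w, P u w * rwHit P w v = ∑ w, d w * rwHit P w v := by
      simp only [Finset.mul_sum]
      rw [Finset.sum_comm]
      refine Finset.sum_congr rfl fun w _ => ?_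
      rw [← hstat w, Finset.sum_mul]
      exact Finset.sum_congr rfl fun x _ => by ring
    have e2 : ∑ u, d u * (1 + (∑ w, P u w * rwHit P w v) - rwHit P u v) = C := by
      simp only [mul_sub, mul_add, mul_one, Finset.sum_sub_distrib, Finset.sum_add_distrib]
      rw [e1]
      ring
    rw [Finset.sum_eq_single v] at e2
    · rwa [rwHit_self_aux, sub_zero] at e2
    · intro b _ hb
      rw [hstep b hb]
      ring
    · simp
  have hπv : π v = d v / C := hπ v
  by_cases huv : u = v
  · subst huv
    rw [if_pos rfl, hπv]
    simp only [rwHit_self_aux, sub_zero]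
    rw [div_mul_eq_mul_div, hret, div_self hC0.ne']
  · rw [if_neg huv]
    have := hstep u huv
    rw [this]
    ring
end

section
/- Let G=(V,E) be a finite connected simple graph with minimum degree δ and maximum degree Δ. Let H(u,v) be the expected hitting time of v from u for the unweighted random walk (which moves to a uniformly random neighbor at each step), and let H'(u,v) be the expected hitting time of v from u for the symmetric random walk with transition probabilities P'_{u,v} = 1/(Δ+1) if {u,v}∈E, P'_{u,u} = 1 − deg(u)/(Δ+1), and P'_{u,v} = 0 otherwise. Then for all vertices u, v: H'(u,v) ≤ ((Δ+1)/δ)·H(u,v). -/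
theorem rwSurvive_self_eq {V : Type*} [Fintype V] [DecidableEq V]
    (P : V → V → ℝ) (v : V) (t : ℕ) : rwSurvive P v t v = 0 := by
  cases t <;> simp [rwSurvive]

theorem rwSurvive_zero_ne {V : Type*} [Fintype V] [DecidableEq V]
    (P : V → V → ℝ) {v x : V} (h : x ≠ v) : rwSurvive P v 0 x = 1 := by
  simp [rwSurvive, h]

theorem rwSurvive_succ_ne {V : Type*} [Fintype V] [DecidableEq V]
    (P : V → V → ℝ) {v x : V} (h : x ≠ v) (t : ℕ) :
    rwSurvive P v (t + 1) x = ∑ w, P x w * rwSurvive P v t w := by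
  simp [rwSurvive, h]

theorem rwSurvive_nn {V : Type*} [Fintype V] [DecidableEq V]
    (P : V → V → ℝ) (h0 : ∀ x y, 0 ≤ P x y) (v : V) (t : ℕ) :
    ∀ x, 0 ≤ rwSurvive P v t x := by
  induction t with
  | zero => intro x; simp only [rwSurvive]; split_ifs <;> norm_num
  | succ t ih =>
    intro x
    simp only [rwSurvive]
    split_ifs
    · exact le_rfl
    · exact Finset.sum_nonneg fun w _ => mul_nonneg (h0 _ _) (ih w)

theorem rwSurvive_le_one {V : Type*} [Fintype V] [DecidableEq V]
    (P : V → V → ℝ) (h0 : ∀ x y, 0 ≤ P x y) (h1 : ∀ x, ∑ y, P x y ≤ 1) (v : V) (t : ℕ) :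
    ∀ x, rwSurvive P v t x ≤ 1 := by
  induction t with
  | zero => intro x; simp only [rwSurvive]; split_ifs <;> norm_num
  | succ t ih =>
    intro x
    simp only [rwSurvive]
    split_ifs
    · norm_num
    · exact (Finset.sum_le_sum fun w _ => mul_le_of_le_one_right (h0 x w) (ih w)).trans (h1 x)

theorem rwSurvive_antitone {V : Type*} [Fintype V] [DecidableEq V]
    (P : V → V → ℝ) (h0 : ∀ x y, 0 ≤ P x y) (h1 : ∀ x, ∑ y, P x y ≤ 1) (v x : V) :
    Antitone fun t => rwSurvive P v t x := by
  apply antitone_nat_of_succ_le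
  intro t
  induction t generalizing x with
  | zero =>
    by_cases hx : x = v
    · subst hx; simp [rwSurvive_self_eq]
    · rw [rwSurvive_zero_ne P hx]; exact rwSurvive_le_one P h0 h1 v _ x
  | succ t ih =>
    by_cases hx : x = v
    · subst hx; simp [rwSurvive_self_eq]
    · rw [rwSurvive_succ_ne P hx, rwSurvive_succ_ne P hx]
      exact Finset.sum_le_sum fun w _ => mul_le_mul_of_nonneg_left (ih w) (h0 x w)

theorem rwSurvive_lt_one {V : Type*} [Fintype V] [DecidableEq V]
    (G : SimpleGraph V)
    (P : V → V → ℝ) (h0 : ∀ x y, 0 ≤ P x y) (h1 : ∀ x, ∑ y, P x y ≤ 1)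
    (hpos : ∀ x y, G.Adj x y → 0 < P x y) {x v : V} (p : G.Walk x v) :
    ∃ t, rwSurvive P v t x < 1 := by
  induction p with
  | nil => exact ⟨0, by simp [rwSurvive_self_eq]⟩
  | @cons a b c hab q ih =>
    obtain ⟨t, ht⟩ := ih
    refine ⟨t + 1, ?_⟩
    by_cases hx : a = c
    · subst hx; simp [rwSurvive_self_eq]
    · rw [rwSurvive_succ_ne P hx]
      refine lt_of_lt_of_le (Finset.sum_lt_sum
        (fun w _ => mul_le_of_le_one_right (h0 a w) (rwSurvive_le_one P h0 h1 c t w))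
        ⟨b, Finset.mem_univ _, ?_⟩) (h1 a)
      exact mul_lt_of_lt_one_right (hpos _ _ hab) ht

theorem rwSurvive_summable {V : Type*} [Fintype V] [DecidableEq V]
    (G : SimpleGraph V) (hconn : G.Connected)
    (P : V → V → ℝ) (h0 : ∀ x y, 0 ≤ P x y) (h1 : ∀ x, ∑ y, P x y ≤ 1)
    (hpos : ∀ x y, G.Adj x y → 0 < P x y) (v x : V) :
    Summable fun t => rwSurvive P v t x := by
  have hex : ∀ y, ∃ t, rwSurvive P v t y < 1 := fun y =>
    rwSurvive_lt_one G P h0 h1 hpos (hconn.preconnected y v).some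
  choose T hT using hex
  set N := ∑ y, T y with hN
  have hlt : ∀ y, rwSurvive P v N y < 1 := fun y =>
    lt_of_le_of_lt (rwSurvive_antitone P h0 h1 v y
      (Finset.single_le_sum (f := T) (fun _ _ => Nat.zero_le _) (Finset.mem_univ y))) (hT y)
  have : Nonempty V := ⟨v⟩
  obtain ⟨z, hz⟩ := Finite.exists_max fun y => rwSurvive P v N y
  set c := rwSurvive P v N z with hc
  have hc1 : c < 1 := hlt z
  have hc0 : 0 ≤ c := rwSurvive_nn P h0 v N z
  have key : ∀ t y, rwSurvive P v (N + t) y ≤ c * rwSurvive P v t y := by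
    intro t
    induction t with
    | zero =>
      intro y
      by_cases hy : y = v
      · subst hy; simp [rwSurvive_self_eq]
      · rw [rwSurvive_zero_ne P hy, mul_one]; exact hz y
    | succ t ih =>
      intro y
      by_cases hy : y = v
      · subst hy; simp [rwSurvive_self_eq]
      · rw [← add_assoc, rwSurvive_succ_ne P hy, rwSurvive_succ_ne P hy, Finset.mul_sum]
        refine Finset.sum_le_sum fun w _ => ?_
        calc _ ≤ P y w * (c * rwSurvive P v t w) := mul_le_mul_of_nonneg_left (ih w) (h0 y w)
          _ = _ := by ring
  refine summable_of_sum_range_le (c := N / (1 - c)) (fun t => rwSurvive_nn P h0 v t x) ?_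
  intro n
  have hc' : 0 < 1 - c := by linarith
  rw [le_div_iff₀ hc']
  have hA : ∑ t ∈ Finset.range n, rwSurvive P v t x
      ≤ ∑ t ∈ Finset.range (N + n), rwSurvive P v t x :=
    Finset.sum_le_sum_of_subset_of_nonneg (Finset.range_mono (by omega))
      fun t _ _ => rwSurvive_nn P h0 v t x
  rw [Finset.sum_range_add] at hA
  have hB : ∑ t ∈ Finset.range N, rwSurvive P v t x ≤ N := by
    simpa using Finset.sum_le_sum fun t (_ : t ∈ Finset.range N) =>
      rwSurvive_le_one P h0 h1 v t x
  have hC : ∑ t ∈ Finset.range n, rwSurvive P v (N + t) x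
      ≤ c * ∑ t ∈ Finset.range n, rwSurvive P v t x := by
    rw [Finset.mul_sum]; exact Finset.sum_le_sum fun t _ => key t x
  linarith

theorem rwHit_le_of_super {V : Type*} [Fintype V] [DecidableEq V]
    (P : V → V → ℝ) (h0 : ∀ x y, 0 ≤ P x y) (v : V) (g : V → ℝ) (hg0 : ∀ x, 0 ≤ g x)
    (hg : ∀ x, x ≠ v → 1 + ∑ w, P x w * g w ≤ g x) (x : V) : rwHit P x v ≤ g x := by
  refine Real.tsum_le_of_sum_range_le (fun t => rwSurvive_nn P h0 v t x) ?_
  intro n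
  induction n generalizing x with
  | zero => simpa using hg0 x
  | succ n ih =>
    by_cases hx : x = v
    · subst hx; simpa [rwSurvive_self_eq] using hg0 x
    · rw [Finset.sum_range_succ', rwSurvive_zero_ne P hx]
      simp only [rwSurvive_succ_ne P hx]
      rw [Finset.sum_comm]
      simp only [← Finset.mul_sum]
      have := Finset.sum_le_sum fun w (_ : w ∈ Finset.univ) =>
        mul_le_mul_of_nonneg_left (ih w) (h0 x w)
      linarith [hg x hx]

theorem rwHit_eq {V : Type*} [Fintype V] [DecidableEq V]
    (P : V → V → ℝ) (v : V) (hs : ∀ x, Summable fun t => rwSurvive P v t x)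
    (x : V) (hx : x ≠ v) : rwHit P x v = 1 + ∑ w, P x w * rwHit P w v := by
  unfold rwHit
  rw [(hs x).tsum_eq_zero_add, rwSurvive_zero_ne P hx]
  simp only [rwSurvive_succ_ne P hx]
  rw [Summable.tsum_finsetSum fun w _ => (hs w).mul_left _]
  simp only [tsum_mul_left]

/-- Let `G` be a finite connected simple graph with minimum degree `δ` and
maximum degree `Δ`. Let `H` be the hitting times of the unweighted random walk on `G` and
`H'` those of the symmetric (lazy) random walk with `P'_{u,v} = 1/(Δ+1)` on edges and
`P'_{u,u} = 1 − deg(u)/(Δ+1)`. Then `H'(u,v) ≤ ((Δ+1)/δ)·H(u,v)` for all vertices `u, v`. -/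
theorem symmetric_hitting_le_ratio_mul_hitting
    {V : Type*} [Fintype V] [DecidableEq V]
    (G : SimpleGraph V) [DecidableRel G.Adj]
    (hconn : G.Connected)
    (P P' : V → V → ℝ)
    (hP : ∀ u v, P u v = if G.Adj u v then ((G.degree u : ℝ))⁻¹ else 0)
    (hP' : ∀ u v, P' u v =
      if G.Adj u v then ((G.maxDegree : ℝ) + 1)⁻¹
      else if u = v then 1 - (G.degree u : ℝ) / ((G.maxDegree : ℝ) + 1) else 0)
    (u v : V) :
    rwHit P' u v ≤ (((G.maxDegree : ℝ) + 1) / (G.minDegree : ℝ)) * rwHit P u v := by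
  have hD : (0 : ℝ) < (G.maxDegree : ℝ) + 1 := by positivity
  by_cases huv : u = v
  · subst huv; simp [rwHit, rwSurvive_self_eq]
  have : Nontrivial V := ⟨u, v, huv⟩
  have hmin : 0 < G.minDegree := hconn.preconnected.minDegree_pos_of_nontrivial
  have hdeg : ∀ x, (G.minDegree : ℝ) ≤ G.degree x := fun x => by
    exact_mod_cast G.minDegree_le_degree x
  have hmin' : (0 : ℝ) < G.minDegree := by exact_mod_cast hmin
  have hdp : ∀ x, (0 : ℝ) < G.degree x := fun x => hmin'.trans_le (hdeg x)
  have h0 : ∀ x y, 0 ≤ P x y := fun x y => by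
    rw [hP]; split_ifs
    · exact inv_nonneg.2 (hdp x).le
    · exact le_rfl
  have hpos : ∀ x y, G.Adj x y → 0 < P x y := fun x y h => by
    rw [hP, if_pos h]; exact inv_pos.2 (hdp x)
  have hsum : ∀ (x : V) (a : ℝ) (f : V → ℝ),
      ∑ w, (if G.Adj x w then a else 0) * f w = a * ∑ w ∈ G.neighborFinset x, f w := by
    intro x a f
    rw [Finset.mul_sum, G.neighborFinset_eq_filter, Finset.sum_filter]
    refine Finset.sum_congr rfl fun w _ => ?_
    split_ifs <;> simp
  have hPs : ∀ x (f : V → ℝ),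
      ∑ w, P x w * f w = (G.degree x : ℝ)⁻¹ * ∑ w ∈ G.neighborFinset x, f w := by
    intro x f
    rw [← hsum]
    simp only [hP]
  have h1 : ∀ x, ∑ y, P x y ≤ 1 := fun x => by
    have := hPs x (fun _ => 1)
    simp only [mul_one, Finset.sum_const, nsmul_eq_mul, G.card_neighborFinset_eq_degree] at this
    rw [this, inv_mul_cancel₀ (hdp x).ne']
  have hs := rwSurvive_summable G hconn P h0 h1 hpos v
  have hH0 : ∀ x, 0 ≤ rwHit P x v := fun x => tsum_nonneg fun t => rwSurvive_nn P h0 v t x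
  have h0' : ∀ x y, 0 ≤ P' x y := fun x y => by
    rw [hP']; split_ifs
    · exact inv_nonneg.2 hD.le
    · have : (G.degree x : ℝ) ≤ G.maxDegree := by exact_mod_cast G.degree_le_maxDegree x
      rw [sub_nonneg, div_le_one hD]; linarith
    · exact le_rfl
  refine rwHit_le_of_super P' h0' v
    (fun x => (((G.maxDegree : ℝ) + 1) / (G.minDegree : ℝ)) * rwHit P x v)
    (fun x => mul_nonneg (by positivity) (hH0 x)) ?_ u
  intro x hx
  have hE := rwHit_eq P v hs x hx
  rw [hPs] at hE
  have hP's : ∀ f : V → ℝ, ∑ w, P' x w * f w =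
      ((G.maxDegree : ℝ) + 1)⁻¹ * ∑ w ∈ G.neighborFinset x, f w
        + (1 - (G.degree x : ℝ) / ((G.maxDegree : ℝ) + 1)) * f x := by
    intro f
    rw [← hsum]
    have : (1 - (G.degree x : ℝ) / ((G.maxDegree : ℝ) + 1)) * f x =
        ∑ w, if x = w then (1 - (G.degree x : ℝ) / ((G.maxDegree : ℝ) + 1)) * f w else 0 := by
      simp
    rw [this, ← Finset.sum_add_distrib]
    refine Finset.sum_congr rfl fun w _ => ?_
    rw [hP']
    by_cases ha : G.Adj x w
    · simp [ha, ha.ne]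
    · by_cases hxw : x = w <;> simp [ha, hxw]
  rw [hP's, ← Finset.mul_sum]
  have hd := hdeg x
  have hdx := hdp x
  set S := ∑ w ∈ G.neighborFinset x, rwHit P w v
  have hS : S = G.degree x * (rwHit P x v - 1) := by
    rw [hE]; field_simp; ring
  rw [hS]
  have hq : 1 ≤ (G.degree x : ℝ) / G.minDegree := (one_le_div hmin').2 hd
  have : ((G.maxDegree : ℝ) + 1)⁻¹ * (((G.maxDegree : ℝ) + 1) / G.minDegree *
      (G.degree x * (rwHit P x v - 1))) + (1 - (G.degree x : ℝ) / ((G.maxDegree : ℝ) + 1)) *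
      (((G.maxDegree : ℝ) + 1) / G.minDegree * rwHit P x v) =
      ((G.maxDegree : ℝ) + 1) / G.minDegree * rwHit P x v - (G.degree x : ℝ) / G.minDegree := by
    field_simp; ring
  linarith
end

section
/- There is an absolute constant C such that the following holds. Let G=(V,E) be a finite connected simple graph with n vertices, minimum degree δ and maximum degree Δ, and let λ₂(P) < 1 be the second-largest eigenvalue in absolute value of the transition matrix P of the unweighted random walk on G (P_{u,v} = 1/deg(u) for {u,v}∈E). Then the deterministic edge cover time satisfies ẼC(G) ≤ C·( (Δ/δ)·n/(1−λ₂(P)) + n·κ̃·(Δ/δ)·Δ·log n/(1−λ₂(P)) ). -/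
/-- A rotor configuration on `G`: each vertex `u` carries a rotor sequence of length `d u`
(encoded as a `(d u)`-periodic map `s u : ℕ → V`) consisting of neighbors of `u`, in which
every neighbor of `u` occurs exactly `d u / deg u` times, together with an initial rotor
position `r0 u`. -/
structure RotorConfig {V : Type*} [Fintype V] [DecidableEq V]
    (G : SimpleGraph V) [DecidableRel G.Adj] where
  d : V → ℕ
  d_pos : ∀ u, 0 < d u
  s : V → ℕ → V
  periodic : ∀ u i, s u (i + d u) = s u i
  adj : ∀ u i, i < d u → G.Adj u (s u i)
  count : ∀ u v, G.Adj u v →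
    ((Finset.range (d u)).filter (fun i => s u i = v)).card = d u / G.degree u
  r0 : V → ℕ

namespace RotorConfig

variable {V : Type*} [Fintype V] [DecidableEq V] {G : SimpleGraph V} [DecidableRel G.Adj]

/-- `κ̃ = max_u d̃(u)/deg(u)`. -/
def kappa (cfg : RotorConfig G) : ℕ :=
  Finset.univ.sup fun u => cfg.d u / G.degree u

/-- One step of the rotor walk; a state is a pair (current vertex, rotor positions). -/
def step (cfg : RotorConfig G) (st : V × (V → ℕ)) : V × (V → ℕ) :=
  (cfg.s st.1 (st.2 st.1), Function.update st.2 st.1 (st.2 st.1 + 1))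

/-- The state of the rotor walk started at `x0` after `t` steps. -/
def state (cfg : RotorConfig G) (x0 : V) : ℕ → V × (V → ℕ)
  | 0 => (x0, cfg.r0)
  | t + 1 => cfg.step (state cfg x0 t)

/-- The position of the rotor walk started at `x0` after `t` steps. -/
def pos (cfg : RotorConfig G) (x0 : V) (t : ℕ) : V := (cfg.state x0 t).1

/-- Every edge of `G` is traversed (in some direction) within the first `t` steps of the
rotor walk started at `x0`. -/
def coversEdges (cfg : RotorConfig G) (x0 : V) (t : ℕ) : Prop :=
  ∀ u v : V, G.Adj u v → ∃ ℓ, 1 ≤ ℓ ∧ ℓ ≤ t ∧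
    ((cfg.pos x0 (ℓ - 1) = u ∧ cfg.pos x0 ℓ = v) ∨
     (cfg.pos x0 (ℓ - 1) = v ∧ cfg.pos x0 ℓ = u))

end RotorConfig

open Finset

/-- `rg G v t u = P^t(u,v)/deg v`. -/
noncomputable def rg {V : Type} [Fintype V] [DecidableEq V] (G : SimpleGraph V)
    [DecidableRel G.Adj] (v : V) : ℕ → V → ℝ
  | 0 => fun u => if u = v then (G.degree v : ℝ)⁻¹ else 0
  | t + 1 => fun u => (G.degree u : ℝ)⁻¹ * ∑ w, if G.Adj u w then rg G v t w else 0

section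
variable {V : Type} [Fintype V] [DecidableEq V] {G : SimpleGraph V} [DecidableRel G.Adj]

lemma sum_adj_one (u : V) : (∑ w, if G.Adj u w then (1:ℝ) else 0) = G.degree u := by
  rw [Finset.sum_boole, ← SimpleGraph.card_neighborFinset_eq_degree]
  congr 2
  ext w; simp

lemma rg_nonneg (v : V) (t : ℕ) (u : V) : 0 ≤ rg G v t u := by
  induction t generalizing u with
  | zero => simp only [rg]; split_ifs <;> positivity
  | succ t ih =>
    simp only [rg]
    apply mul_nonneg (by positivity)
    apply Finset.sum_nonneg
    intro w _
    split_ifs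
    · exact ih w
    · exact le_rfl

lemma sum_adj_swap (f : V → ℝ) :
    ∑ u, ∑ w, (if G.Adj u w then f w else 0) = ∑ w, (G.degree w : ℝ) * f w := by
  rw [Finset.sum_comm]
  apply Finset.sum_congr rfl
  intro w _
  rw [← sum_adj_one, Finset.sum_mul]
  apply Finset.sum_congr rfl
  intro u _
  simp [G.adj_comm]

lemma rg_sum (hd : ∀ u, 0 < G.degree u) (v : V) (t : ℕ) :
    ∑ u, (G.degree u : ℝ) * rg G v t u = 1 := by
  have hd' : ∀ u, (G.degree u : ℝ) ≠ 0 := fun u => by exact_mod_cast (hd u).ne'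
  induction t with
  | zero => simp [rg, hd']
  | succ t ih =>
    rw [← ih, ← sum_adj_swap (G := G) (fun w => rg G v t w)]
    apply Finset.sum_congr rfl
    intro u _
    simp only [rg]
    rw [mul_inv_cancel_left₀ (hd' u)]

/-- Symmetrised transition matrix. -/
noncomputable def symN (G : SimpleGraph V) [DecidableRel G.Adj] : Matrix V V ℝ :=
  Matrix.of fun u v => if G.Adj u v then (√(G.degree u : ℝ))⁻¹ * (√(G.degree v : ℝ))⁻¹ else 0

lemma symN_herm : (symN G).IsHermitian := by
  ext u v
  simp only [symN, Matrix.conjTranspose_apply, Matrix.of_apply, star_trivial, G.adj_comm v u]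
  split_ifs <;> ring

lemma rg_eq (hd : ∀ u, 0 < G.degree u) (v : V) (t : ℕ) (u : V) :
    rg G v t u = (√(G.degree u : ℝ))⁻¹ * (√(G.degree v : ℝ))⁻¹ * ((symN G) ^ t) u v := by
  have hd' : ∀ u, (0:ℝ) < (G.degree u : ℝ) := fun u => by exact_mod_cast (hd u)
  induction t generalizing u with
  | zero =>
    simp only [rg, pow_zero, Matrix.one_apply]
    split_ifs with h
    · subst h
      rw [← mul_inv, Real.mul_self_sqrt (hd' u).le, mul_one]
    · simp
  | succ t ih =>
    simp only [rg, pow_succ', Matrix.mul_apply, Finset.mul_sum]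
    apply Finset.sum_congr rfl
    intro w _
    have hN : symN G u w =
        if G.Adj u w then (√(G.degree u : ℝ))⁻¹ * (√(G.degree w : ℝ))⁻¹ else 0 := rfl
    rw [hN]
    split_ifs
    · rw [ih w]
      have h1 : (G.degree u : ℝ)⁻¹ = (√(G.degree u : ℝ))⁻¹ * (√(G.degree u : ℝ))⁻¹ := by
        rw [← mul_inv, Real.mul_self_sqrt (hd' u).le]
      rw [h1]
      ring
    · simp

/-- eigenvectors transfer -/
lemma symN_eig (hd : ∀ u, 0 < G.degree u) (e : V → ℝ) (μ : ℝ)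
    (h : (symN G).mulVec e = μ • e) (u : V) :
    (∑ w, if G.Adj u w then (√(G.degree w : ℝ))⁻¹ * e w else 0)
      = μ * (G.degree u * ((√(G.degree u : ℝ))⁻¹ * e u)) := by
  have hd' : ∀ u, (0:ℝ) < (G.degree u : ℝ) := fun u => by exact_mod_cast (hd u)
  have hs := Real.sqrt_pos.2 (hd' u)
  have h1 := congrFun h u
  simp only [Matrix.mulVec, dotProduct, symN, Matrix.of_apply, Pi.smul_apply, smul_eq_mul] at h1
  have h2 : (∑ w, if G.Adj u w then (√(G.degree w : ℝ))⁻¹ * e w else 0) =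
      √(G.degree u : ℝ) * (μ * e u) := by
    rw [← h1, Finset.mul_sum]
    apply Finset.sum_congr rfl
    intro w _
    split_ifs
    · field_simp
    · simp
  rw [h2]
  nth_rewrite 2 [← Real.mul_self_sqrt (hd' u).le]
  field_simp

lemma spectral_bound (hG : G.Connected) (hd : ∀ u, 0 < G.degree u) (lam2 : ℝ)
    (hlam0 : 0 ≤ lam2)
    (hlam : ∀ μ : ℝ, μ ≠ 1 → Module.End.HasEigenvalue
              (Matrix.mulVecLin
                (Matrix.of fun u v : V =>
                  if G.Adj u v then ((G.degree u : ℝ))⁻¹ else 0)) μ → |μ| ≤ lam2)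
    (k : ℕ) (u v : V) :
    (∑ w, (G.degree w : ℝ))⁻¹ - lam2 ^ k ≤ rg G v k u := by
  have hd' : ∀ u, (0:ℝ) < (G.degree u : ℝ) := fun u => by exact_mod_cast (hd u)
  have hs' : ∀ u, (0:ℝ) < √(G.degree u : ℝ) := fun u => Real.sqrt_pos.2 (hd' u)
  have hs1 : ∀ u, (√(G.degree u : ℝ))⁻¹ ≤ 1 := fun u => by
    apply inv_le_one_of_one_le₀
    rw [Real.one_le_sqrt]
    exact_mod_cast hd u
  set M : ℝ := ∑ w, (G.degree w : ℝ) with hM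
  have hMpos : 0 < M := Finset.sum_pos (fun w _ => hd' w) ⟨u, Finset.mem_univ _⟩
  set N := symN G with hN
  have hH : N.IsHermitian := symN_herm
  let b := hH.eigenvectorBasis
  let μ := hH.eigenvalues
  have hev : ∀ i, N.mulVec (b i) = μ i • (b i : V → ℝ) := fun i => hH.mulVec_eigenvectorBasis i
  have hpow : ∀ i (t : ℕ), (N ^ t).mulVec (b i) = (μ i) ^ t • (b i : V → ℝ) := by
    intro i t
    induction t with
    | zero => simp
    | succ t ih =>
      rw [pow_succ, ← Matrix.mulVec_mulVec, hev, Matrix.mulVec_smul, ih, smul_smul, pow_succ']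
  have hexp0 : ∀ x : V, (Pi.single x 1 : V → ℝ) = ∑ i, (b i x) • (b i : V → ℝ) := by
    intro x
    have := b.sum_repr' (EuclideanSpace.single x (1:ℝ))
    have h2 := congrArg (WithLp.ofLp) this
    simp only [EuclideanSpace.inner_single_right] at h2
    simpa using h2.symm
  have hexp : ∀ (t : ℕ) (x y : V), (N ^ t) x y = ∑ i, (μ i) ^ t * (b i x * b i y) := by
    intro t x y
    have h1 : (N ^ t) x y = (N ^ t).mulVec (Pi.single y 1) x := by simp
    rw [h1, hexp0 y, Matrix.mulVec_sum]
    simp only [Matrix.mulVec_smul, hpow, Finset.sum_apply, Pi.smul_apply, smul_eq_mul]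
    apply Finset.sum_congr rfl
    intro i _
    ring
  have hnorm : ∀ x, ∑ i, b i x * b i x = 1 := by
    intro x
    have := hexp 0 x x
    simpa using this.symm
  have hbne : ∀ i, (b i : V → ℝ) ≠ 0 := by
    intro i h
    have h1 := b.orthonormal.ne_zero i
    apply h1
    ext x
    exact congrFun h x
  have hbn : ∀ i, ∑ x, b i x * b i x = 1 := by
    intro i
    have h1 := b.orthonormal.1 i
    rw [EuclideanSpace.norm_eq] at h1
    have h2 : ∑ x, ‖b i x‖ ^ 2 = 1 := by
      have := congrArg (· ^ 2) h1
      simp only at this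
      rwa [Real.sq_sqrt (by positivity), one_pow] at this
    rw [← h2]
    apply Finset.sum_congr rfl
    intro x _
    simp [sq]
  -- eigenvalues different from 1
  have hsmall : ∀ i, μ i ≠ 1 → |μ i| ≤ lam2 := by
    intro i hi
    apply hlam _ hi
    apply Module.End.hasEigenvalue_of_hasEigenvector (x := fun w => (√(G.degree w : ℝ))⁻¹ * b i w)
    rw [Module.End.hasEigenvector_iff, Module.End.mem_eigenspace_iff]
    constructor
    · ext x
      have h := symN_eig hd _ _ (hev i) x
      simp only [Matrix.mulVecLin_apply, Matrix.mulVec, dotProduct, Matrix.of_apply,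
        Pi.smul_apply, smul_eq_mul]
      have h3 : (∑ w, (if G.Adj x w then (G.degree x : ℝ)⁻¹ else 0) *
          ((√(G.degree w : ℝ))⁻¹ * b i w)) = (G.degree x : ℝ)⁻¹ *
          (∑ w, if G.Adj x w then (√(G.degree w : ℝ))⁻¹ * b i w else 0) := by
        rw [Finset.mul_sum]
        apply Finset.sum_congr rfl
        intro w _
        split_ifs <;> simp
      rw [h3, h]
      have := hd' x
      field_simp
    · intro h
      apply hbne i
      ext x
      have := congrFun h x
      simpa [(hs' x).ne'] using this
  -- eigenvectors for 1
  have hone : ∀ i, μ i = 1 → b i u * b i v = √(G.degree u : ℝ) * √(G.degree v : ℝ) / M := by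
    intro i hi
    have hlap : (G.lapMatrix ℝ).mulVec (fun w => (√(G.degree w : ℝ))⁻¹ * b i w) = 0 := by
      ext x
      have h := symN_eig hd _ _ (hev i) x
      rw [hi, one_mul] at h
      rw [SimpleGraph.lapMatrix_mulVec_apply, ← h, Pi.zero_apply, sub_eq_zero, ← Finset.sum_filter]
      apply Finset.sum_congr _ (fun _ _ => rfl)
      ext w; simp
    rw [SimpleGraph.lapMatrix_mulVec_eq_zero_iff_forall_reachable] at hlap
    have hc : ∀ x, b i x = √(G.degree x : ℝ) * ((√(G.degree u : ℝ))⁻¹ * b i u) := by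
      intro x
      have := hlap x u (hG.preconnected x u)
      rw [← this]
      have := (hs' x).ne'
      field_simp
    set c := ((√(G.degree u : ℝ))⁻¹ * b i u) with hcdef
    have hcM : c * c * M = 1 := by
      rw [← hbn i, hM, Finset.mul_sum]
      apply Finset.sum_congr rfl
      intro x _
      rw [hc x]
      nth_rewrite 1 [← Real.mul_self_sqrt (hd' x).le]
      ring
    rw [hc u, hc v, eq_div_iff hMpos.ne']
    linear_combination (√(G.degree u : ℝ) * √(G.degree v : ℝ)) * hcM
  have hex : ∃ i, μ i = 1 := by
    have h1 : (1:ℝ) ∈ spectrum ℝ N := by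
      have : Module.End.HasEigenvalue (Matrix.toLin' N) 1 := by
        apply Module.End.hasEigenvalue_of_hasEigenvector (x := fun w => √(G.degree w : ℝ))
        rw [Module.End.hasEigenvector_iff, Module.End.mem_eigenspace_iff]
        constructor
        · ext x
          simp only [Matrix.toLin'_apply, Matrix.mulVec, dotProduct, hN, symN, Matrix.of_apply,
            one_smul]
          have h3 : (∑ w, (if G.Adj x w then (√(G.degree x : ℝ))⁻¹ * (√(G.degree w : ℝ))⁻¹
              else 0) * √(G.degree w : ℝ)) = (√(G.degree x : ℝ))⁻¹ *
              ∑ w, (if G.Adj x w then (1:ℝ) else 0) := by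
            rw [Finset.mul_sum]
            apply Finset.sum_congr rfl
            intro w _
            have := (hs' w).ne'
            split_ifs
            · field_simp
            · simp
          rw [h3, sum_adj_one]
          nth_rewrite 2 [← Real.mul_self_sqrt (hd' x).le]
          have := (hs' x).ne'
          field_simp
        · intro h
          exact (hs' u).ne' (congrFun h u)
      rw [← Matrix.spectrum_toLin']
      exact this.mem_spectrum
    rw [hH.spectrum_real_eq_range_eigenvalues] at h1
    exact h1
  obtain ⟨i0, hi0⟩ := hex
  -- lower bound for the power
  have hterm : ∀ i, (if i = i0 then √(G.degree u : ℝ) * √(G.degree v : ℝ) / M else 0)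
      - lam2 ^ k * ((b i u * b i u + b i v * b i v) / 2) ≤ (μ i) ^ k * (b i u * b i v) := by
    intro i
    have hl : 0 ≤ lam2 ^ k := by positivity
    have hq : 0 ≤ (b i u * b i u + b i v * b i v) / 2 := by
      have := mul_self_nonneg (b i u)
      have := mul_self_nonneg (b i v)
      linarith
    by_cases hi : μ i = 1
    · rw [hi, one_pow, one_mul, hone i hi]
      have : 0 ≤ √(G.degree u : ℝ) * √(G.degree v : ℝ) / M := by positivity
      split_ifs <;> nlinarith
    · have hne : i ≠ i0 := fun h => hi (h ▸ hi0)
      rw [if_neg hne]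
      have h1 : |(μ i) ^ k * (b i u * b i v)| ≤
          lam2 ^ k * ((b i u * b i u + b i v * b i v) / 2) := by
        rw [abs_mul, abs_pow]
        apply mul_le_mul
        · exact pow_le_pow_left₀ (abs_nonneg _) (hsmall i hi) k
        · rw [abs_le]
          constructor <;> nlinarith [sq_nonneg (b i u - b i v), sq_nonneg (b i u + b i v)]
        · positivity
        · positivity
      have := (abs_le.1 h1).1
      linarith
  have hlow : √(G.degree u : ℝ) * √(G.degree v : ℝ) / M - lam2 ^ k ≤ (N ^ k) u v := by
    rw [hexp]
    refine le_trans (le_of_eq ?_) (Finset.sum_le_sum (fun i _ => hterm i))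
    rw [Finset.sum_sub_distrib, ← Finset.mul_sum, ← Finset.sum_div, Finset.sum_add_distrib,
      hnorm, hnorm]
    simp
  rw [rg_eq hd]
  have hpp : 0 < (√(G.degree u : ℝ))⁻¹ * (√(G.degree v : ℝ))⁻¹ :=
    mul_pos (inv_pos.2 (hs' u)) (inv_pos.2 (hs' v))
  have hpp1 : (√(G.degree u : ℝ))⁻¹ * (√(G.degree v : ℝ))⁻¹ ≤ 1 :=
    mul_le_one₀ (hs1 u) (inv_nonneg.2 (hs' v).le) (hs1 v)
  have h5 := mul_le_mul_of_nonneg_left hlow hpp.le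
  refine le_trans ?_ h5
  have h6 : (√(G.degree u : ℝ))⁻¹ * (√(G.degree v : ℝ))⁻¹ *
      (√(G.degree u : ℝ) * √(G.degree v : ℝ) / M) = M⁻¹ := by
    have := (hs' u).ne'
    have := (hs' v).ne'
    field_simp
  rw [mul_sub, h6]
  have : 0 ≤ lam2 ^ k := by positivity
  nlinarith

end

section
variable {V : Type} [Fintype V] [DecidableEq V] {G : SimpleGraph V} [DecidableRel G.Adj]

lemma rc_adj (cfg : RotorConfig G) (u : V) (i : ℕ) : G.Adj u (cfg.s u i) := by
  have h : ∀ i, cfg.s u i = cfg.s u (i % cfg.d u) := by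
    intro i
    exact ((show Function.Periodic (cfg.s u) (cfg.d u) from cfg.periodic u).map_mod_nat i).symm
  rw [h]
  exact cfg.adj u _ (Nat.mod_lt _ (cfg.d_pos u))

lemma rc_d (cfg : RotorConfig G) (u : V) : cfg.d u = G.degree u * (cfg.d u / G.degree u) := by
  have h := Finset.card_eq_sum_card_fiberwise (s := Finset.range (cfg.d u))
    (t := G.neighborFinset u) (f := cfg.s u)
    (fun i _ => by simpa using rc_adj cfg u i)
  rw [Finset.card_range, Finset.sum_congr rfl
    (fun v hv => cfg.count u v (by simpa using hv))] at h
  simpa using h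

lemma rc_le (cfg : RotorConfig G) (u : V) : cfg.d u ≤ G.degree u * cfg.kappa := by
  rw [rc_d cfg u]
  apply Nat.mul_le_mul_left
  exact Finset.le_sup (f := fun u => cfg.d u / G.degree u) (Finset.mem_univ u)

lemma rc_q_pos (cfg : RotorConfig G) (u : V) : 0 < cfg.d u / G.degree u := by
  have h := rc_d cfg u
  have := cfg.d_pos u
  by_contra h0
  have h1 : cfg.d u / G.degree u = 0 := Nat.eq_zero_of_not_pos h0
  rw [h1, Nat.mul_zero] at h
  omega

lemma rc_deg_pos (cfg : RotorConfig G) (u : V) : 0 < G.degree u := by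
  rw [SimpleGraph.degree_pos_iff_exists_adj]
  exact ⟨_, rc_adj cfg u 0⟩

/-- rotor position at time `t` -/
def rpos (cfg : RotorConfig G) (x0 : V) (t : ℕ) : V → ℕ := (cfg.state x0 t).2

lemma pos_succ (cfg : RotorConfig G) (x0 : V) (t : ℕ) :
    cfg.pos x0 (t+1) = cfg.s (cfg.pos x0 t) (rpos cfg x0 t (cfg.pos x0 t)) := rfl

lemma rpos_succ (cfg : RotorConfig G) (x0 : V) (t : ℕ) (u : V) :
    rpos cfg x0 (t+1) u = rpos cfg x0 t u + if u = cfg.pos x0 t then 1 else 0 := by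
  show Function.update (cfg.state x0 t).2 (cfg.state x0 t).1 _ u = _
  rw [Function.update_apply]
  unfold rpos RotorConfig.pos
  split_ifs with h
  · rw [h]
  · rfl

lemma rpos_ge (cfg : RotorConfig G) (x0 : V) (t : ℕ) (u : V) : cfg.r0 u ≤ rpos cfg x0 t u := by
  induction t with
  | zero => exact le_rfl
  | succ t ih => rw [rpos_succ]; omega

lemma rpos_sum (cfg : RotorConfig G) (x0 : V) (t : ℕ) :
    ∑ u, ((rpos cfg x0 t u : ℝ) - cfg.r0 u) = t := by
  induction t with
  | zero => simp [rpos, RotorConfig.state]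
  | succ t ih =>
    have : ∀ u, ((rpos cfg x0 (t+1) u : ℝ) - cfg.r0 u) =
      ((rpos cfg x0 t u : ℝ) - cfg.r0 u) + if u = cfg.pos x0 t then 1 else 0 := by
      intro u
      rw [rpos_succ]
      push_cast
      ring
    simp only [this, Finset.sum_add_distrib, ih]
    simp

lemma exists_time (cfg : RotorConfig G) (x0 : V) (t : ℕ) (u : V) (i : ℕ)
    (h1 : cfg.r0 u ≤ i) (h2 : i < rpos cfg x0 t u) :
    ∃ l < t, cfg.pos x0 l = u ∧ cfg.pos x0 (l+1) = cfg.s u i := by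
  induction t with
  | zero => exact absurd h2 (by simp [rpos, RotorConfig.state, h1])
  | succ t ih =>
    by_cases h : i < rpos cfg x0 t u
    · obtain ⟨l, hl, h3⟩ := ih h
      exact ⟨l, by omega, h3⟩
    · rw [rpos_succ] at h2
      split_ifs at h2 with hu
      · have : i = rpos cfg x0 t u := by omega
        refine ⟨t, by omega, hu.symm, ?_⟩
        rw [pos_succ, ← hu, this]
      · omega

lemma covers_of (cfg : RotorConfig G) (x0 : V) (t : ℕ)
    (h : ∀ u, cfg.r0 u + cfg.d u ≤ rpos cfg x0 t u) : cfg.coversEdges x0 t := by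
  intro u v huv
  have hc := cfg.count u v huv
  have hp : 0 < ((Finset.range (cfg.d u)).filter (fun i => cfg.s u i = v)).card := by
    rw [hc]; exact rc_q_pos cfg u
  obtain ⟨i, hi⟩ := Finset.card_pos.1 hp
  rw [Finset.mem_filter] at hi
  have hper : Function.Periodic (cfg.s u) (cfg.d u) := cfg.periodic u
  have him : i ∈ (Finset.Ico (cfg.r0 u) (cfg.r0 u + cfg.d u)).image (· % cfg.d u) := by
    rw [Nat.image_Ico_mod]; exact hi.1
  obtain ⟨j, hj, hj2⟩ := Finset.mem_image.1 him
  rw [Finset.mem_Ico] at hj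
  obtain ⟨l, hl, h3, h4⟩ := exists_time cfg x0 t u j hj.1 (lt_of_lt_of_le hj.2 (h u))
  refine ⟨l+1, by omega, by omega, Or.inl ⟨by simpa using h3, ?_⟩⟩
  rw [h4, ← hper.map_mod_nat j]
  rw [hj2, hi.2]

lemma telescope (cfg : RotorConfig G) (x0 : V) (f : V → ℝ) (t : ℕ) :
    f (cfg.pos x0 t) - f x0 =
      ∑ u, ∑ i ∈ Finset.Ico (cfg.r0 u) (rpos cfg x0 t u), (f (cfg.s u i) - f u) := by
  induction t with
  | zero => simp [rpos, RotorConfig.state, RotorConfig.pos]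
  | succ t ih =>
    have : ∀ u, ∑ i ∈ Finset.Ico (cfg.r0 u) (rpos cfg x0 (t+1) u), (f (cfg.s u i) - f u) =
      ∑ i ∈ Finset.Ico (cfg.r0 u) (rpos cfg x0 t u), (f (cfg.s u i) - f u) +
       if u = cfg.pos x0 t then f (cfg.pos x0 (t+1)) - f (cfg.pos x0 t) else 0 := by
      intro u
      rw [rpos_succ]
      split_ifs with h
      · rw [Finset.sum_Ico_succ_top (rpos_ge _ _ _ _), pos_succ, ← h]
      · simp
    simp only [this, Finset.sum_add_distrib, ← ih]
    simp

lemma cycle_sum (cfg : RotorConfig G) (f : V → ℝ) (u : V) (a : ℕ) :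
    ∑ i ∈ Finset.Ico a (a + cfg.d u), f (cfg.s u i) =
      (cfg.d u : ℝ) * ((G.degree u : ℝ)⁻¹ * ∑ w, if G.Adj u w then f w else 0) := by
  have h0 : ∑ i ∈ Finset.Ico a (a + cfg.d u), f (cfg.s u i) =
      ∑ i ∈ Finset.range (cfg.d u), f (cfg.s u i) := by
    have hper : Function.Periodic (fun i => f (cfg.s u i)) (cfg.d u) := by
      intro i; simp only [cfg.periodic]
    induction a with
    | zero => simp
    | succ a ih =>
      rw [← ih]
      have h1 := Finset.sum_Ico_succ_top (f := fun i => f (cfg.s u i))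
        (show a ≤ a + cfg.d u by omega)
      have h2 := Finset.sum_eq_sum_Ico_succ_bot (f := fun i => f (cfg.s u i))
        (show a < a + cfg.d u + 1 by omega)
      have h3 := hper a
      simp only at h3
      rw [show a + 1 + cfg.d u = a + cfg.d u + 1 by ring]
      linarith
  have hq := rc_d cfg u
  have hdp := rc_deg_pos cfg u
  rw [h0, ← Finset.sum_fiberwise_of_maps_to (s := Finset.range (cfg.d u))
    (t := G.neighborFinset u) (g := cfg.s u) (fun i _ => by simpa using rc_adj cfg u i)]
  have h1 : ∀ v ∈ G.neighborFinset u, ∑ i ∈ (Finset.range (cfg.d u)).filter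
      (fun i => cfg.s u i = v), f (cfg.s u i) = ((cfg.d u / G.degree u : ℕ) : ℝ) * f v := by
    intro v hv
    rw [← cfg.count u v (by simpa using hv), Finset.sum_congr rfl
      (g := fun _ => f v) (fun i hi => by rw [(Finset.mem_filter.1 hi).2])]
    simp
  rw [Finset.sum_congr rfl h1, ← Finset.mul_sum, ← Finset.sum_filter, ← mul_assoc]
  have h2 : G.neighborFinset u = Finset.univ.filter (fun w => G.Adj u w) := by ext w; simp
  rw [h2]
  congr 1
  have h3 : (cfg.d u : ℝ) = G.degree u * ((cfg.d u / G.degree u : ℕ) : ℝ) := by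
    exact_mod_cast hq
  have h4 : (G.degree u : ℝ) ≠ 0 := by exact_mod_cast hdp.ne'
  rw [h3, mul_right_comm, mul_inv_cancel₀ h4, one_mul]

lemma partial_sum (cfg : RotorConfig G) (f : V → ℝ) (hf : ∀ u, 0 ≤ f u) (u : V) (a n : ℕ) :
    ((n : ℝ) - cfg.d u) * ((G.degree u : ℝ)⁻¹ * ∑ w, if G.Adj u w then f w else 0)
      ≤ ∑ i ∈ Finset.Ico a (a + n), f (cfg.s u i) := by
  have hP : 0 ≤ ((G.degree u : ℝ)⁻¹ * ∑ w, if G.Adj u w then f w else 0) := by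
    apply mul_nonneg (by positivity)
    apply Finset.sum_nonneg
    intro w _
    split_ifs
    · exact hf w
    · exact le_rfl
  induction n using Nat.strong_induction_on generalizing a with
  | _ n ih =>
    by_cases h : n < cfg.d u
    · have h1 : (n : ℝ) - cfg.d u ≤ 0 := by
        have : (n : ℝ) < cfg.d u := by exact_mod_cast h
        linarith
      exact le_trans (mul_nonpos_of_nonpos_of_nonneg h1 hP)
        (Finset.sum_nonneg (fun i _ => hf _))
    · have hdp := cfg.d_pos u
      obtain ⟨m, rfl⟩ : ∃ m, n = cfg.d u + m := ⟨n - cfg.d u, by omega⟩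
      have h2 := ih m (by omega) (a + cfg.d u)
      rw [← Finset.sum_Ico_consecutive _ (show a ≤ a + cfg.d u by omega)
        (show a + cfg.d u ≤ a + (cfg.d u + m) by omega), cycle_sum, ← add_assoc]
      push_cast
      linarith

end

section
variable {V : Type} [Fintype V] [DecidableEq V] {G : SimpleGraph V} [DecidableRel G.Adj]

lemma visits_bound (cfg : RotorConfig G) (x0 v : V) (k t : ℕ) (c : ℝ)
    (hc : ∀ u, c ≤ rg G v k u) :
    c * t - (cfg.kappa + 1) * k ≤
      ((rpos cfg x0 t v : ℝ) - cfg.r0 v) * (G.degree v : ℝ)⁻¹ := by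
  have hd : ∀ u, 0 < G.degree u := rc_deg_pos cfg
  have hd' : ∀ u, (0:ℝ) < (G.degree u : ℝ) := fun u => by exact_mod_cast (hd u)
  set f : V → ℝ := fun u => ∑ j ∈ Finset.range k, rg G v j u with hf
  have hf0 : ∀ u, 0 ≤ f u := fun u => Finset.sum_nonneg (fun j _ => rg_nonneg v j u)
  have hfs : ∑ u, (G.degree u : ℝ) * f u = k := by
    simp only [hf, Finset.mul_sum]
    rw [Finset.sum_comm]
    simp [rg_sum hd]
  have hfle : ∀ u, f u ≤ k := by
    intro u
    rw [← hfs]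
    have h1 : (1:ℝ) ≤ G.degree u := by exact_mod_cast hd u
    have h2 : f u ≤ (G.degree u : ℝ) * f u := by nlinarith [hf0 u]
    exact h2.trans (Finset.single_le_sum (f := fun u => (G.degree u : ℝ) * f u)
      (fun w _ => mul_nonneg (hd' w).le (hf0 w)) (Finset.mem_univ u))
  set Pf : V → ℝ := fun u => (G.degree u : ℝ)⁻¹ * ∑ w, if G.Adj u w then f w else 0 with hPf
  have hPf1 : ∀ u, Pf u = ∑ j ∈ Finset.range k, rg G v (j+1) u := by
    intro u
    simp only [hPf, hf, rg, ← Finset.mul_sum]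
    congr 1
    rw [Finset.sum_comm]
    apply Finset.sum_congr rfl
    intro w _
    split_ifs <;> simp
  have hPf2 : ∀ u, Pf u - f u = rg G v k u - rg G v 0 u := by
    intro u
    rw [hPf1, hf, ← Finset.sum_sub_distrib, Finset.sum_range_sub (fun j => rg G v j u)]
  have hPf0 : ∀ u, 0 ≤ Pf u := fun u => by
    rw [hPf1]; exact Finset.sum_nonneg (fun j _ => rg_nonneg v _ u)
  have hPfs : ∑ u, (G.degree u : ℝ) * Pf u = k := by
    rw [← hfs, ← sum_adj_swap (G := G) f]
    apply Finset.sum_congr rfl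
    intro u _
    simp only [hPf]
    rw [mul_inv_cancel_left₀ (hd' u).ne']
  have htel := telescope cfg x0 f t
  have hterm : ∀ u, ((rpos cfg x0 t u : ℝ) - cfg.r0 u) * c
      - ((rpos cfg x0 t u : ℝ) - cfg.r0 u) * (if u = v then (G.degree v : ℝ)⁻¹ else 0)
      - cfg.kappa * (G.degree u * Pf u) ≤
      ∑ i ∈ Finset.Ico (cfg.r0 u) (rpos cfg x0 t u), (f (cfg.s u i) - f u) := by
    intro u
    obtain ⟨n, hn⟩ := Nat.exists_eq_add_of_le (rpos_ge cfg x0 t u)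
    have h1 := partial_sum cfg f hf0 u (cfg.r0 u) n
    change ((n:ℝ) - cfg.d u) * Pf u ≤ _ at h1
    have h2 : (cfg.d u : ℝ) ≤ G.degree u * cfg.kappa := by exact_mod_cast rc_le cfg u
    have h3 := mul_le_mul_of_nonneg_right h2 (hPf0 u)
    rw [hn, Finset.sum_sub_distrib]
    have h4 := hPf2 u
    have h5 : rg G v 0 u = if u = v then (G.degree v : ℝ)⁻¹ else 0 := rfl
    have h6 := hc u
    rw [← h5]
    have h7 : (0:ℝ) ≤ n := by positivity
    simp only [Finset.sum_const, Nat.card_Ico, nsmul_eq_mul, add_tsub_cancel_left]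
    push_cast
    have h8 : (n:ℝ) * c ≤ n * (Pf u - f u + rg G v 0 u) := by
      apply mul_le_mul_of_nonneg_left _ h7
      linarith
    nlinarith
  have hsum := Finset.sum_le_sum (fun u (_ : u ∈ Finset.univ) => hterm u)
  rw [← htel, Finset.sum_sub_distrib, Finset.sum_sub_distrib, ← Finset.sum_mul, rpos_sum,
    ← Finset.mul_sum, hPfs] at hsum
  simp only [mul_ite, mul_zero, Finset.sum_ite_eq', Finset.mem_univ, if_true] at hsum
  have h1 := hfle (cfg.pos x0 t)
  have h2 := hf0 x0
  linarith

end

/-- There is an absolute constant `C` such that for every finite connected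
simple graph `G` on `n` vertices with minimum degree `δ`, maximum degree `Δ`, and
second-largest eigenvalue (in absolute value) `λ₂ < 1` of the transition matrix of the
unweighted random walk, the deterministic edge cover time satisfies
`ẼC(G) ≤ C·((Δ/δ)·n/(1−λ₂) + n·κ̃·(Δ/δ)·Δ·log n/(1−λ₂))`. -/
theorem detEdgeCover_le_expansion_bound :
    ∃ C : ℝ, 0 < C ∧
      ∀ (V : Type) [Fintype V] [DecidableEq V]
        (G : SimpleGraph V) [DecidableRel G.Adj],
        G.Connected →
        ∀ lam2 : ℝ,
          IsGreatest {x : ℝ | ∃ μ : ℝ, μ ≠ 1 ∧ |μ| = x ∧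
            Module.End.HasEigenvalue
              (Matrix.mulVecLin
                (Matrix.of fun u v : V =>
                  if G.Adj u v then ((G.degree u : ℝ))⁻¹ else 0)) μ} lam2 →
          lam2 < 1 →
          ∀ (cfg : RotorConfig G) (x0 : V),
            ∃ t : ℕ,
              (t : ℝ) ≤ C *
                (((G.maxDegree : ℝ) / (G.minDegree : ℝ)) * (Fintype.card V : ℝ) / (1 - lam2)
                  + (Fintype.card V : ℝ) * (cfg.kappa : ℝ) *
                      ((G.maxDegree : ℝ) / (G.minDegree : ℝ)) *
                      ((G.maxDegree : ℝ) * Real.logb 2 (Fintype.card V : ℝ) / (1 - lam2))) ∧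
              cfg.coversEdges x0 t := by
  refine ⟨18, by norm_num, ?_⟩
  intro V _ _ G _ hG lam2 hlam hlt cfg x0
  have hd : ∀ u, 0 < G.degree u := rc_deg_pos cfg
  have hd' : ∀ u, (0:ℝ) < (G.degree u : ℝ) := fun u => by exact_mod_cast (hd u)
  have hlam0 : 0 ≤ lam2 := by
    obtain ⟨⟨μ, _, h, _⟩, _⟩ := hlam
    rw [← h]; exact abs_nonneg _
  have hlam' : ∀ μ : ℝ, μ ≠ 1 → Module.End.HasEigenvalue
              (Matrix.mulVecLin
                (Matrix.of fun u v : V =>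
                  if G.Adj u v then ((G.degree u : ℝ))⁻¹ else 0)) μ → |μ| ≤ lam2 :=
    fun μ h1 h2 => hlam.2 ⟨μ, h1, rfl, h2⟩
  have hn2 : 2 ≤ Fintype.card V := by
    have := (rc_adj cfg x0 0).ne
    have : Nontrivial V := ⟨_, _, this⟩
    exact Fintype.one_lt_card
  have hn2' : (2:ℝ) ≤ Fintype.card V := by exact_mod_cast hn2
  set n : ℝ := (Fintype.card V : ℝ) with hn
  have hk1 : 1 ≤ cfg.kappa :=
    (rc_q_pos cfg x0).trans_le
      (Finset.le_sup (f := fun u => cfg.d u / G.degree u) (Finset.mem_univ x0))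
  have hk1' : (1:ℝ) ≤ cfg.kappa := by exact_mod_cast hk1
  set K : ℝ := (cfg.kappa : ℝ) with hK
  set M : ℕ := ∑ w, G.degree w with hM
  have hMr : (M : ℝ) = ∑ w, (G.degree w : ℝ) := by rw [hM]; push_cast; rfl
  have hMpos : (0:ℝ) < M := by
    rw [hMr]; exact Finset.sum_pos (fun w _ => hd' w) ⟨x0, Finset.mem_univ _⟩
  have hMle : (M:ℝ) ≤ n * G.maxDegree := by
    have h : M ≤ Fintype.card V * G.maxDegree := by
      rw [hM]
      calc ∑ w, G.degree w ≤ ∑ _w : V, G.maxDegree :=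
            Finset.sum_le_sum (fun w _ => G.degree_le_maxDegree w)
        _ = _ := by simp
    rw [hn]; exact_mod_cast h
  have hDle : (G.maxDegree : ℝ) ≤ n := by
    rw [hn]
    have : Nonempty V := ⟨x0⟩
    exact_mod_cast G.maxDegree_lt_card_verts.le
  set D : ℝ := (G.maxDegree : ℝ) with hD
  have hDx : (G.degree x0 : ℝ) ≤ D := by rw [hD]; exact_mod_cast G.degree_le_maxDegree x0
  have hD1 : (1:ℝ) ≤ D := by
    have : (1:ℝ) ≤ G.degree x0 := by exact_mod_cast hd x0
    linarith
  have hmin : (G.minDegree : ℝ) ≤ D :=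
    le_trans (by exact_mod_cast G.minDegree_le_degree x0) hDx
  have hminpos : (0:ℝ) < G.minDegree := by
    have : Nonempty V := ⟨x0⟩
    obtain ⟨w, hw⟩ := G.exists_minimal_degree_vertex
    rw [hw]; exact hd' w
  have hratio : 1 ≤ D / (G.minDegree : ℝ) := by
    rw [le_div_iff₀ hminpos]; linarith
  set R : ℝ := D / (G.minDegree : ℝ) with hR
  set g : ℝ := 1 - lam2 with hg
  have hgpos : 0 < g := by rw [hg]; linarith
  have hg1 : g ≤ 1 := by rw [hg]; linarith
  set L : ℝ := Real.logb 2 n with hL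
  have hL1 : 1 ≤ L := by
    rw [hL, Real.le_logb_iff_rpow_le (by norm_num) (by linarith)]
    simpa using hn2'
  have hlogL : Real.log n ≤ L := by
    rw [hL, Real.logb, le_div_iff₀ (Real.log_pos (by norm_num))]
    have h1 : Real.log 2 ≤ 1 := by
      have := Real.log_two_lt_d9
      linarith
    have h2 : 0 ≤ Real.log n := Real.log_nonneg (by linarith)
    nlinarith
  have hlogM : Real.log (2 * M) ≤ 3 * L := by
    have h1 : (2:ℝ) * M ≤ n ^ 3 := by
      have : (M:ℝ) ≤ n * n := hMle.trans (by nlinarith)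
      nlinarith [mul_nonneg (by linarith : (0:ℝ) ≤ n - 2) (mul_self_nonneg n)]
    have h2 := Real.log_le_log (by positivity) h1
    rw [Real.log_pow] at h2
    push_cast at h2
    linarith
  set k : ℕ := ⌈Real.log (2 * M) / g⌉₊ with hk
  have hkge : Real.log (2 * M) / g ≤ k := Nat.le_ceil _
  have hM1 : (1:ℝ) ≤ M := by
    have h : 0 < M := by exact_mod_cast hMpos
    exact_mod_cast h
  have hkle : (k:ℝ) ≤ 4 * L / g := by
    have h0 : 0 ≤ Real.log (2 * M) / g :=
      div_nonneg (Real.log_nonneg (by linarith)) hgpos.le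
    have h1 := (Nat.ceil_lt_add_one h0).le
    have h2 : Real.log (2 * M) / g ≤ 3 * L / g := by gcongr
    have h3 : 1 ≤ L / g := by
      rw [le_div_iff₀ hgpos]; linarith
    have h4 : 4 * L / g = 3 * L / g + L / g := by ring
    rw [h4]
    linarith
  have hpow : lam2 ^ k ≤ (2 * (M:ℝ))⁻¹ := by
    have h1 : lam2 ≤ Real.exp (-g) := by
      have := Real.add_one_le_exp (-g)
      rw [hg] at this ⊢
      linarith
    have h2 : lam2 ^ k ≤ Real.exp (-g) ^ k := pow_le_pow_left₀ hlam0 h1 k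
    rw [← Real.exp_nat_mul] at h2
    refine h2.trans ?_
    rw [← Real.exp_log (show (0:ℝ) < 2 * M by positivity), ← Real.exp_neg, Real.exp_le_exp]
    rw [div_le_iff₀ hgpos] at hkge
    linarith
  have hlow : ∀ v u, (2 * (M:ℝ))⁻¹ ≤ rg G v k u := by
    intro v u
    have h := spectral_bound hG hd lam2 hlam0 hlam' k u v
    rw [← hMr] at h
    have h2 : (M:ℝ)⁻¹ = (2 * (M:ℝ))⁻¹ + (2 * (M:ℝ))⁻¹ := by field_simp; norm_num
    linarith
  refine ⟨2 * M * ((cfg.kappa + 1) * k + cfg.kappa), ?_, ?_⟩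
  · push_cast
    rw [← hK]
    have hLg : 1 ≤ L / g := by
      rw [le_div_iff₀ hgpos]; linarith
    have h1 : (K + 1) * k + K ≤ 9 * (K * (L / g)) := by
      have h2 : (K + 1) * k ≤ (2 * K) * (4 * L / g) := by
        apply mul_le_mul (by linarith) hkle (by positivity) (by linarith)
      have h3 : (2 * K) * (4 * L / g) = 8 * (K * (L / g)) := by ring
      nlinarith
    have h2 : 2 * (M:ℝ) * ((K + 1) * k + K) ≤ 2 * (n * D) * (9 * (K * (L / g))) := by
      apply mul_le_mul (by linarith) h1
      · have : (0:ℝ) ≤ k := by positivity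
        nlinarith
      · nlinarith
    have h3 : 0 ≤ n * K * (D * L / g) := by positivity
    have h4 : 0 ≤ R * n / g := by positivity
    have h5 : n * K * (D * L / g) ≤ R * (n * K * (D * L / g)) := le_mul_of_one_le_left h3 hratio
    have h6 : 2 * (n * D) * (9 * (K * (L / g))) = 18 * (n * K * (D * L / g)) := by ring
    have h7 : n * K * R * (D * L / g) = R * (n * K * (D * L / g)) := by ring
    rw [h7]
    linarith
  · apply covers_of
    intro v
    have h := visits_bound cfg x0 v k (2 * M * ((cfg.kappa + 1) * k + cfg.kappa)) _ (hlow v)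
    set T := 2 * M * ((cfg.kappa + 1) * k + cfg.kappa) with hT
    have hTr : (2 * (M:ℝ))⁻¹ * (T : ℝ) = (K + 1) * k + K := by
      rw [hT]; push_cast
      rw [← hK]
      field_simp
    rw [hTr] at h
    have h1 : K ≤ ((rpos cfg x0 T v : ℝ) - cfg.r0 v) * (G.degree v : ℝ)⁻¹ := by linarith
    rw [← div_eq_mul_inv, le_div_iff₀ (hd' v)] at h1
    have h2 : (cfg.d v : ℝ) ≤ G.degree v * cfg.kappa := by exact_mod_cast rc_le cfg v
    have h3 : (cfg.r0 v : ℝ) + cfg.d v ≤ rpos cfg x0 T v := by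
      rw [hK] at h1
      linarith
    exact_mod_cast h3
end

section
/- There is an absolute constant C such that the following holds. Let G=(V,E) be a finite connected simple graph with n vertices, minimum degree δ and maximum degree Δ, let H(u,v) denote the expected hitting time of v from u for the unweighted random walk on G, and for each s∈V let f_s be the flow on the edges of G minimizing Σ_{{i,j}∈E} f_s(i,j)² among all flows in which s sends one unit of flow to every other vertex. Then the deterministic edge cover time satisfies ẼC(G) ≤ C·( (Δ/δ)·max_{u,v∈V} H(u,v) + Δ·n·κ̃ + κ̃·Δ·max_{s∈V} Σ_{{i,j}∈E} |f_s(i,j)| ). -/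
/-- A flow on the edges of `G` in which the source `s` sends one unit of flow to every
other vertex: `f` is antisymmetric, supported on edges, has net inflow `1` at every
vertex `v ≠ s`, and net outflow `n − 1` at `s`. -/
def IsUnitFlow {V : Type*} [Fintype V] (G : SimpleGraph V) (s : V) (f : V → V → ℝ) : Prop :=
  (∀ i j, f i j = - f j i) ∧
  (∀ i j, ¬ G.Adj i j → f i j = 0) ∧
  (∀ v, v ≠ s → ∑ j, f j v = 1) ∧
  (∑ j, f s j = (Fintype.card V : ℝ) - 1)

/-- `f` minimizes the energy `∑_{{i,j}∈E} f(i,j)²` among all flows sending one unit from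
`s` to every other vertex.  (For an antisymmetric `f` supported on edges,
`∑_{{i,j}∈E} f(i,j)² = (1/2)·∑_{i}∑_{j} f(i,j)²`.) -/
def IsMinUnitFlow {V : Type*} [Fintype V] (G : SimpleGraph V) (s : V) (f : V → V → ℝ) :
    Prop :=
  IsUnitFlow G s f ∧
  ∀ g : V → V → ℝ, IsUnitFlow G s g →
    (1 / 2 : ℝ) * ∑ i, ∑ j, (f i j) ^ 2 ≤ (1 / 2 : ℝ) * ∑ i, ∑ j, (g i j) ^ 2


section Helpers

variable {V : Type*} [Fintype V] [DecidableEq V]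

/-- Elementary antisymmetric flow along the ordered pair `(u,v)`. -/
def edgeFlow (u v : V) (i j : V) : ℝ :=
  (if i = u ∧ j = v then 1 else 0) - (if j = u ∧ i = v then 1 else 0)

lemma edgeFlow_antisymm (u v i j : V) : edgeFlow u v i j = - edgeFlow u v j i := by
  unfold edgeFlow; ring

lemma edgeFlow_sum (u v i : V) :
    ∑ j, edgeFlow u v i j = (if i = u then 1 else 0) - (if i = v then 1 else 0) := by
  unfold edgeFlow
  rw [Finset.sum_sub_distrib]
  congr 1
  · by_cases h : i = u <;> simp [h]
  · by_cases h : i = v <;> simp [h]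

lemma edgeFlow_abs (u v i j : V) : |edgeFlow u v i j| ≤ 1 := by
  unfold edgeFlow
  split_ifs <;> simp

lemma minFlow_orth {G : SimpleGraph V} {s : V} {f : V → V → ℝ} (hf : IsMinUnitFlow G s f)
    {g : V → V → ℝ} (ha : ∀ i j, g i j = - g j i) (hs : ∀ i j, ¬ G.Adj i j → g i j = 0)
    (hd : ∀ i, ∑ j, g i j = 0) : ∑ i, ∑ j, f i j * g i j = 0 := by
  obtain ⟨⟨f1, f2, f3, f4⟩, hmin⟩ := hf
  have hd' : ∀ i, ∑ j, g j i = 0 := by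
    intro i
    have : ∑ j, g j i = - ∑ j, g i j := by
      rw [← Finset.sum_neg_distrib]; exact Finset.sum_congr rfl fun j _ => ha j i
    rw [this, hd, neg_zero]
  have key : ∀ e : ℝ, 0 ≤ 2 * e * (∑ i, ∑ j, f i j * g i j) + e ^ 2 * ∑ i, ∑ j, (g i j) ^ 2 := by
    intro e
    have h := hmin (fun i j => f i j + e * g i j) ⟨?_, ?_, ?_, ?_⟩
    · have : ∑ i, ∑ j, (f i j + e * g i j) ^ 2 = ∑ i, ∑ j, (f i j) ^ 2 +
          (2 * e * (∑ i, ∑ j, f i j * g i j) + e ^ 2 * ∑ i, ∑ j, (g i j) ^ 2) := by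
        simp only [Finset.mul_sum, ← Finset.sum_add_distrib]
        refine Finset.sum_congr rfl fun i _ => Finset.sum_congr rfl fun j _ => ?_
        ring
      rw [this] at h
      linarith
    · intro i j
      simp only
      rw [f1 i j, ha i j]; ring
    · intro i j h
      simp only
      rw [f2 i j h, hs i j h]; ring
    · intro v hv
      simp only
      rw [Finset.sum_add_distrib, ← Finset.mul_sum, hd', f3 v hv]; ring
    · simp only
      rw [Finset.sum_add_distrib, ← Finset.mul_sum, hd, f4]; ring
  set B := ∑ i, ∑ j, f i j * g i j
  have hA : 0 ≤ ∑ i, ∑ j, (g i j) ^ 2 :=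
    Finset.sum_nonneg fun i _ => Finset.sum_nonneg fun j _ => sq_nonneg _
  set A := ∑ i, ∑ j, (g i j) ^ 2
  have h := key (-B / (A + 1))
  have hA1 : 0 < A + 1 := by linarith
  have h2 : 2 * (-B / (A + 1)) * B + (-B / (A + 1)) ^ 2 * A
      = - (B ^ 2 * (A + 2)) / (A + 1) ^ 2 := by
    field_simp; ring
  rw [h2] at h
  have h3 : 0 ≤ - (B ^ 2 * (A + 2)) := by
    by_contra hc
    push Not at hc
    exact absurd h (not_le.mpr (div_neg_of_neg_of_pos hc (by positivity)))
  have : B ^ 2 ≤ 0 := by nlinarith [sq_nonneg B]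
  exact pow_eq_zero_iff (two_ne_zero) |>.mp (le_antisymm this (sq_nonneg B))

lemma path_flow {G : SimpleGraph V} {a b : V} (p : G.Walk a b) (hp : p.IsPath) :
    ∃ q : V → V → ℝ, (∀ i j, q i j = - q j i) ∧ (∀ i j, ¬ G.Adj i j → q i j = 0) ∧
      (∀ i, ∑ j, q i j = (if i = a then 1 else 0) - (if i = b then 1 else 0)) ∧
      (∀ i j, |q i j| ≤ 1) ∧ (∀ i j, i ∉ p.support → q i j = 0) := by
  induction p with
  | nil => exact ⟨fun _ _ => 0, by simp, by simp, by simp, by simp, by simp⟩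
  | @cons u v w h p ih =>
    rw [SimpleGraph.Walk.cons_isPath_iff] at hp
    obtain ⟨q, q1, q2, q3, q4, q5⟩ := ih hp.1
    have huv : u ≠ v := h.ne
    refine ⟨fun i j => edgeFlow u v i j + q i j, ?_, ?_, ?_, ?_, ?_⟩
    · intro i j
      simp only
      rw [edgeFlow_antisymm, q1]; ring
    · intro i j hij
      simp only
      rw [q2 i j hij, add_zero]
      unfold edgeFlow
      rw [if_neg, if_neg, sub_zero]
      · rintro ⟨rfl, rfl⟩; exact hij h.symm
      · rintro ⟨rfl, rfl⟩; exact hij h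
    · intro i
      rw [Finset.sum_add_distrib, edgeFlow_sum, q3]; ring
    · intro i j
      simp only
      by_cases hi : i = u
      · subst hi
        rw [q5 i j hp.2, add_zero]; exact edgeFlow_abs _ _ _ _
      · by_cases hj : j = u
        · subst hj
          rw [q1, q5 j i hp.2, neg_zero, add_zero]; exact edgeFlow_abs _ _ _ _
        · have : edgeFlow u v i j = 0 := by simp [edgeFlow, hi, hj]
          rw [this, zero_add]; exact q4 i j
    · intro i j hi
      simp only [SimpleGraph.Walk.support_cons, List.mem_cons, not_or] at hi
      have hv : i ≠ v := by
        rintro rfl; exact hi.2 p.start_mem_support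
      simp [edgeFlow, hi.1, hv, q5 i j hi.2]

variable {G : SimpleGraph V} [DecidableRel G.Adj]

namespace RotorConfig

variable (cfg : RotorConfig G)

lemma adj_all (u : V) (i : ℕ) : G.Adj u (cfg.s u i) := by
  have hper : Function.Periodic (cfg.s u) (cfg.d u) := cfg.periodic u
  rw [← hper.map_mod_nat]
  exact cfg.adj u _ (Nat.mod_lt _ (cfg.d_pos u))

lemma d_eq (u : V) : cfg.d u = G.degree u * (cfg.d u / G.degree u) := by
  have h := Finset.card_eq_sum_card_fiberwise (s := Finset.range (cfg.d u))
    (t := G.neighborFinset u) (f := cfg.s u) (by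
      intro i _
      simpa using cfg.adj_all u i)
  rw [Finset.card_range] at h
  rw [Finset.sum_congr rfl (fun v hv => cfg.count u v (by simpa using hv))] at h
  simpa using h

lemma degree_pos (cfg : RotorConfig G) (u : V) : 0 < G.degree u :=
  (G.degree_pos_iff_exists_adj u).mpr ⟨_, cfg.adj_all u 0⟩

lemma kappa_ge (u : V) : cfg.d u / G.degree u ≤ cfg.kappa :=
  Finset.le_sup (f := fun u => cfg.d u / G.degree u) (Finset.mem_univ u)

lemma ratio_pos (u : V) : 1 ≤ cfg.d u / G.degree u := by
  rcases Nat.eq_zero_or_pos (cfg.d u / G.degree u) with h | h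
  · have := cfg.d_eq u
    rw [h] at this
    have := cfg.d_pos u
    omega
  · exact h

/-- Number of occurrences of `v` in the rotor sequence of `u` on a window. -/
def win (u v : V) (a b : ℕ) : ℕ := ((Finset.Ico a b).filter (fun i => cfg.s u i = v)).card

lemma win_period {u v : V} (h : G.Adj u v) (a : ℕ) :
    cfg.win u v a (a + cfg.d u) = cfg.d u / G.degree u := by
  have hper : Function.Periodic (fun i => cfg.s u i = v) (cfg.d u) := by
    intro i; simp [cfg.periodic]
  unfold win
  rw [Nat.filter_Ico_card_eq_of_periodic _ _ _ hper, Nat.count_eq_card_filter_range, cfg.count u v h]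

lemma win_mono {u v : V} {a b b' : ℕ} (h : b ≤ b') : cfg.win u v a b ≤ cfg.win u v a b' :=
  Finset.card_le_card (Finset.filter_subset_filter _ (Finset.Ico_subset_Ico le_rfl h))

lemma win_add {u v : V} {a b c : ℕ} (h : a ≤ b) (h' : b ≤ c) :
    cfg.win u v a c = cfg.win u v a b + cfg.win u v b c := by
  unfold win
  rw [← Finset.Ico_union_Ico_eq_Ico h h', Finset.filter_union, Finset.card_union_of_disjoint]
  exact Finset.disjoint_filter_filter (Finset.Ico_disjoint_Ico_consecutive a b c)

lemma win_succ {u v : V} {a b : ℕ} (h : a ≤ b) :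
    cfg.win u v a (b + 1) = cfg.win u v a b + if cfg.s u b = v then 1 else 0 := by
  rw [cfg.win_add h (Nat.le_succ b)]
  congr 1
  unfold win
  simp only [Nat.succ_eq_add_one, Nat.Ico_succ_singleton, Finset.filter_singleton]
  split_ifs <;> simp

lemma d_div (u : V) : (cfg.d u : ℝ) / G.degree u = ((cfg.d u / G.degree u : ℕ) : ℝ) := by
  have h := cfg.d_eq u
  have h1 : (cfg.d u : ℝ) = G.degree u * ((cfg.d u / G.degree u : ℕ) : ℝ) := by exact_mod_cast h
  have h2 : (0 : ℝ) < G.degree u := by exact_mod_cast cfg.degree_pos u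
  rw [div_eq_iff h2.ne', mul_comm]; exact h1

lemma win_disc {u v : V} (h : G.Adj u v) (N : ℕ) : ∀ a,
    |(cfg.win u v a (a + N) : ℝ) - N / G.degree u| ≤ cfg.kappa := by
  have hdeg : (0 : ℝ) < G.degree u := by exact_mod_cast cfg.degree_pos u
  have hk : ((cfg.d u / G.degree u : ℕ) : ℝ) ≤ cfg.kappa := by exact_mod_cast cfg.kappa_ge u
  induction N using Nat.strong_induction_on with
  | _ N ih =>
    intro a
    rcases lt_or_ge N (cfg.d u) with hN | hN
    · have h1 : cfg.win u v a (a + N) ≤ cfg.d u / G.degree u := by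
        rw [← cfg.win_period h a]; exact cfg.win_mono (by omega)
      have h1' : (cfg.win u v a (a + N) : ℝ) ≤ ((cfg.d u / G.degree u : ℕ) : ℝ) := by
        exact_mod_cast h1
      have h2 : (N : ℝ) / G.degree u ≤ ((cfg.d u / G.degree u : ℕ) : ℝ) := by
        rw [← cfg.d_div u]
        gcongr
      have h3 : (0 : ℝ) ≤ N / G.degree u := by positivity
      have h4 : (0 : ℝ) ≤ cfg.win u v a (a + N) := by positivity
      rw [abs_le]; constructor <;> linarith
    · obtain ⟨M, rfl⟩ := Nat.exists_eq_add_of_le hN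
      have h1 := ih M (by have := cfg.d_pos u; omega) (a + cfg.d u)
      rw [cfg.win_add (b := a + cfg.d u) (by omega) (by omega), cfg.win_period h]
      rw [← add_assoc]
      push_cast
      rw [add_div, cfg.d_div]
      convert h1 using 2
      ring

variable (x0 : V)

lemma state_ge (t : ℕ) (u : V) : cfg.r0 u ≤ (cfg.state x0 t).2 u := by
  induction t with
  | zero => simp [state]
  | succ t ih =>
    simp only [state, step, Function.update_apply]
    split_ifs with h
    · subst h; omega
    · exact ih

/-- Number of visits. -/
def visits (t : ℕ) (u : V) : ℕ := (cfg.state x0 t).2 u - cfg.r0 u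

/-- Number of traversals. -/
def trav (t : ℕ) (u v : V) : ℕ := cfg.win u v (cfg.r0 u) ((cfg.state x0 t).2 u)

lemma visits_sum (t : ℕ) : ∑ u, cfg.visits x0 t u = t := by
  induction t with
  | zero => simp [visits, state]
  | succ t ih =>
    have : ∀ u, cfg.visits x0 (t + 1) u
        = cfg.visits x0 t u + if u = (cfg.state x0 t).1 then 1 else 0 := by
      intro u
      have := cfg.state_ge x0 t u
      simp only [visits, state, step, Function.update_apply]
      split_ifs with h
      · subst h; omega
      · omega
    simp only [this, Finset.sum_add_distrib, ih]
    simp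

lemma trav_succ (t : ℕ) (u v : V) : cfg.trav x0 (t + 1) u v = cfg.trav x0 t u v +
    if u = cfg.pos x0 t ∧ v = cfg.pos x0 (t + 1) then 1 else 0 := by
  have hpos : cfg.pos x0 (t + 1) = cfg.s (cfg.pos x0 t) ((cfg.state x0 t).2 (cfg.pos x0 t)) := rfl
  have hst : (cfg.state x0 (t + 1)).2 u
      = if u = cfg.pos x0 t then (cfg.state x0 t).2 u + 1 else (cfg.state x0 t).2 u := by
    have h1 : (cfg.state x0 (t + 1)).2 u = Function.update (cfg.state x0 t).2 (cfg.pos x0 t)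
      ((cfg.state x0 t).2 (cfg.pos x0 t) + 1) u := rfl
    rw [h1, Function.update_apply]
    by_cases h : u = cfg.pos x0 t
    · rw [if_pos h, if_pos h, ← h]
    · rw [if_neg h, if_neg h]
  unfold trav
  rw [hst, hpos]
  by_cases h : u = cfg.pos x0 t
  · rw [if_pos h, cfg.win_succ (cfg.state_ge x0 t u)]
    simp [← h, eq_comm]
  · simp [h]

lemma trav_disc (t : ℕ) {u v : V} (h : G.Adj u v) :
    |(cfg.trav x0 t u v : ℝ) - cfg.visits x0 t u / G.degree u| ≤ cfg.kappa := by
  have := cfg.win_disc h (cfg.visits x0 t u) (cfg.r0 u)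
  have e : cfg.r0 u + cfg.visits x0 t u = (cfg.state x0 t).2 u := by
    have := cfg.state_ge x0 t u
    unfold visits; omega
  rw [e] at this
  exact this

lemma trav_pos (t : ℕ) {u v : V} (h : 0 < cfg.trav x0 t u v) :
    ∃ l, 1 ≤ l ∧ l ≤ t ∧ cfg.pos x0 (l - 1) = u ∧ cfg.pos x0 l = v := by
  induction t with
  | zero => simp [trav, state, win] at h
  | succ t ih =>
    rw [trav_succ] at h
    split_ifs at h with hc
    · exact ⟨t + 1, by omega, le_rfl, by simpa using hc.1.symm, hc.2.symm⟩
    · obtain ⟨l, h1, h2, h3⟩ := ih h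
      exact ⟨l, h1, by omega, h3⟩

lemma trav_pos_of_visits (t : ℕ) {u v : V} (h : G.Adj u v) (hv : cfg.d u ≤ cfg.visits x0 t u) :
    0 < cfg.trav x0 t u v := by
  have h1 := cfg.win_period h (cfg.r0 u)
  have h2 := cfg.ratio_pos u
  have h3 : cfg.win u v (cfg.r0 u) (cfg.r0 u + cfg.d u) ≤ cfg.trav x0 t u v := by
    apply cfg.win_mono
    unfold visits at hv
    have := cfg.d_pos u
    omega
  omega

lemma trav_zero (t : ℕ) {u v : V} (h : ¬ G.Adj u v) : cfg.trav x0 t u v = 0 := by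
  unfold trav win
  rw [Finset.card_eq_zero, Finset.filter_eq_empty_iff]
  intro i _ hi
  exact h (hi ▸ cfg.adj_all u i)

/-- Net traversals. -/
noncomputable def net (t : ℕ) (i j : V) : ℝ := (cfg.trav x0 t i j : ℝ) - cfg.trav x0 t j i

lemma net_sum (t : ℕ) (i : V) : ∑ j, cfg.net x0 t i j =
    (if i = x0 then 1 else 0) - (if i = cfg.pos x0 t then 1 else 0) := by
  induction t with
  | zero =>
    have h0 : cfg.pos x0 0 = x0 := rfl
    rw [h0, sub_self]
    simp [net, trav, state, win]
  | succ t ih =>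
    have : ∀ j, cfg.net x0 (t + 1) i j
        = cfg.net x0 t i j + edgeFlow (cfg.pos x0 t) (cfg.pos x0 (t + 1)) i j := by
      intro j
      unfold net edgeFlow
      rw [trav_succ, trav_succ]
      push_cast
      ring
    simp only [this, Finset.sum_add_distrib, ih, edgeFlow_sum]
    ring

lemma net_flow (hG : G.Connected) {s : V} {f : V → V → ℝ} (hf : IsMinUnitFlow G s f) (t : ℕ) :
    |∑ i, ∑ j, f i j * cfg.net x0 t i j| ≤ ∑ i, ∑ j, |f i j| := by
  obtain ⟨p, hp⟩ := hG.exists_isPath (cfg.pos x0 t) x0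
  obtain ⟨q, q1, q2, q3, q4, -⟩ := path_flow p hp
  have h := minFlow_orth hf (g := fun i j => cfg.net x0 t i j + q i j)
    (by intro i j; rw [q1 i j]; unfold net; ring)
    (by
      intro i j hij
      have hji : ¬ G.Adj j i := fun h => hij h.symm
      simp [net, q2 i j hij, cfg.trav_zero x0 t hij, cfg.trav_zero x0 t hji])
    (by intro i; rw [Finset.sum_add_distrib, net_sum, q3]; ring)
  have h2 : ∑ i, ∑ j, f i j * cfg.net x0 t i j = - ∑ i, ∑ j, f i j * q i j := by
    simp only [mul_add, Finset.sum_add_distrib] at h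
    linarith
  rw [h2, abs_neg]
  refine (Finset.abs_sum_le_sum_abs _ _).trans (Finset.sum_le_sum fun i _ => ?_)
  refine (Finset.abs_sum_le_sum_abs _ _).trans (Finset.sum_le_sum fun j _ => ?_)
  rw [abs_mul]
  exact mul_le_of_le_one_right (abs_nonneg _) (q4 i j)

/-- Identity for a unit flow tested against a vertex function. -/
lemma flow_test {G : SimpleGraph V} {s : V} {f : V → V → ℝ} (hf : IsUnitFlow G s f) (h : V → ℝ) :
    ∑ i, ∑ j, f i j * (h i - h j) = 2 * (Fintype.card V * h s - ∑ v, h v) := by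
  obtain ⟨f1, f2, f3, f4⟩ := hf
  have hout : ∀ i, ∑ j, f i j = (if i = s then (Fintype.card V : ℝ) else 0) - 1 := by
    intro i
    split_ifs with hi
    · rw [hi, f4]
    · have : ∑ j, f i j = - ∑ j, f j i := by
        rw [← Finset.sum_neg_distrib]; exact Finset.sum_congr rfl fun j _ => f1 i j
      rw [this, f3 i hi]; ring
  have hA : ∑ i, ∑ j, f i j * h i = Fintype.card V * h s - ∑ v, h v := by
    simp only [← Finset.sum_mul, hout, sub_mul, Finset.sum_sub_distrib, one_mul, ite_mul, zero_mul]
    simp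
  have hB : ∑ i, ∑ j, f i j * h j = - ∑ i, ∑ j, f i j * h i := by
    rw [Finset.sum_comm, ← Finset.sum_neg_distrib]
    refine Finset.sum_congr rfl fun i _ => ?_
    rw [← Finset.sum_neg_distrib]
    refine Finset.sum_congr rfl fun j _ => ?_
    rw [f1 j i]; ring
  simp only [mul_sub, Finset.sum_sub_distrib]
  rw [hB, hA]; ring

lemma main_bound (hG : G.Connected) {s : V} {f : V → V → ℝ} (hf : IsMinUnitFlow G s f) (t : ℕ)
    (hs : cfg.visits x0 t s < cfg.d s) :
    (t : ℝ) ≤ G.maxDegree * (Fintype.card V * cfg.kappa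
      + 3 * cfg.kappa * ((1 / 2 : ℝ) * ∑ i, ∑ j, |f i j|)) := by
  set h : V → ℝ := fun u => cfg.visits x0 t u / G.degree u with hh
  have hdeg : ∀ u, (0 : ℝ) < G.degree u := fun u => by exact_mod_cast cfg.degree_pos u
  have hk1 : (1 : ℝ) ≤ cfg.kappa := by
    exact_mod_cast (cfg.ratio_pos s).trans (cfg.kappa_ge s)
  have hhs : h s ≤ cfg.kappa := by
    have h1 : h s ≤ (cfg.d s : ℝ) / G.degree s := by
      simp only [hh]
      gcongr
    rw [cfg.d_div] at h1
    exact h1.trans (by exact_mod_cast cfg.kappa_ge s)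
  have hF : 0 ≤ ∑ i, ∑ j, |f i j| :=
    Finset.sum_nonneg fun i _ => Finset.sum_nonneg fun j _ => abs_nonneg _
  have hn := cfg.net_flow x0 hG hf t
  have hdiff : |∑ i, ∑ j, f i j * (cfg.net x0 t i j - (h i - h j))|
      ≤ 2 * cfg.kappa * ∑ i, ∑ j, |f i j| := by
    simp only [Finset.mul_sum]
    refine (Finset.abs_sum_le_sum_abs _ _).trans (Finset.sum_le_sum fun i _ => ?_)
    refine (Finset.abs_sum_le_sum_abs _ _).trans (Finset.sum_le_sum fun j _ => ?_)
    rw [abs_mul, mul_comm]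
    by_cases hij : G.Adj i j
    · refine mul_le_mul_of_nonneg_right ?_ (abs_nonneg _)
      have a1 := abs_le.mp (cfg.trav_disc x0 t hij)
      have a2 := abs_le.mp (cfg.trav_disc x0 t hij.symm)
      simp only [net, hh]
      rw [abs_le]
      constructor <;> linarith [a1.1, a1.2, a2.1, a2.2]
    · simp [hf.1.2.1 i j hij]
  have hsplit : ∑ i, ∑ j, f i j * (cfg.net x0 t i j - (h i - h j)) =
      ∑ i, ∑ j, f i j * cfg.net x0 t i j - ∑ i, ∑ j, f i j * (h i - h j) := by
    simp only [mul_sub, Finset.sum_sub_distrib]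
  rw [hsplit, flow_test hf.1] at hdiff
  have b1 := abs_le.mp hdiff
  have b2 := abs_le.mp hn
  have hcard : (Fintype.card V : ℝ) * h s ≤ Fintype.card V * cfg.kappa := by gcongr
  have hsum : ∑ v, h v ≤ Fintype.card V * cfg.kappa
      + 3 * cfg.kappa * ((1 / 2 : ℝ) * ∑ i, ∑ j, |f i j|) := by
    nlinarith [b1.1, b1.2, b2.1, b2.2, mul_nonneg (sub_nonneg.mpr hk1) hF]
  have ht : (t : ℝ) = ∑ v, (G.degree v : ℝ) * h v := by
    have h1 : (t : ℝ) = ∑ v, (cfg.visits x0 t v : ℝ) := by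
      exact_mod_cast (cfg.visits_sum x0 t).symm
    rw [h1]
    refine Finset.sum_congr rfl fun v _ => ?_
    simp only [hh]
    rw [mul_div_cancel₀]
    exact (hdeg v).ne'
  have hle : ∑ v, (G.degree v : ℝ) * h v ≤ G.maxDegree * ∑ v, h v := by
    rw [Finset.mul_sum]
    refine Finset.sum_le_sum fun v _ => ?_
    have h0 : 0 ≤ h v := by simp only [hh]; positivity
    have h1 : (G.degree v : ℝ) ≤ G.maxDegree := by exact_mod_cast G.degree_le_maxDegree v
    exact mul_le_mul_of_nonneg_right h1 h0
  rw [ht]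
  refine hle.trans ?_
  gcongr

end RotorConfig

lemma rwSurvive_nonneg (P : V → V → ℝ) (hP : ∀ u v, 0 ≤ P u v) (v : V) (t : ℕ) :
    ∀ u, 0 ≤ rwSurvive P v t u := by
  induction t with
  | zero => intro u; simp only [rwSurvive]; split_ifs <;> norm_num
  | succ t ih =>
    intro u
    simp only [rwSurvive]
    split_ifs
    · exact le_rfl
    · exact Finset.sum_nonneg fun w _ => mul_nonneg (hP u w) (ih w)

end Helpers

/-- There is an absolute constant `C` such that for every finite connected
simple graph `G` on `n` vertices, with `H` the hitting times of the unweighted random walk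
and `f_s` the ℓ²-minimal unit flows, the deterministic edge cover time satisfies
`ẼC(G) ≤ C·((Δ/δ)·max_{u,v} H(u,v) + Δ·n·κ̃ + κ̃·Δ·max_s ∑_{{i,j}∈E} |f_s(i,j)|)`. -/
theorem detEdgeCover_le_flow_bound :
    ∃ C : ℝ, 0 < C ∧
      ∀ (V : Type) [Fintype V] [DecidableEq V]
        (G : SimpleGraph V) [DecidableRel G.Adj],
        G.Connected →
        ∀ P : V → V → ℝ,
          (∀ u v, P u v = if G.Adj u v then ((G.degree u : ℝ))⁻¹ else 0) →
        ∀ f : V → V → V → ℝ,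
          (∀ s : V, IsMinUnitFlow G s (f s)) →
        ∀ (cfg : RotorConfig G) (x0 : V),
          ∃ t : ℕ,
            (t : ℝ) ≤ C *
              (((G.maxDegree : ℝ) / (G.minDegree : ℝ)) * (⨆ u, ⨆ v, rwHit P u v)
                + (G.maxDegree : ℝ) * (Fintype.card V : ℝ) * (cfg.kappa : ℝ)
                + (cfg.kappa : ℝ) * (G.maxDegree : ℝ) *
                    (⨆ s : V, (1 / 2 : ℝ) * ∑ i, ∑ j, |f s i j|)) ∧
            cfg.coversEdges x0 t := by
  refine ⟨3, by norm_num, ?_⟩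
  intro V _ _ G _ hG P hP f hf cfg x0
  have hP0 : ∀ u v, 0 ≤ P u v := by
    intro u v
    rw [hP]
    split_ifs
    · positivity
    · exact le_rfl
  have hH : 0 ≤ ⨆ u, ⨆ v, rwHit P u v :=
    Real.iSup_nonneg fun u => Real.iSup_nonneg fun v =>
      tsum_nonneg fun t => rwSurvive_nonneg P hP0 v t u
  have hHH : 0 ≤ ((G.maxDegree : ℝ) / (G.minDegree : ℝ)) * (⨆ u, ⨆ v, rwHit P u v) :=
    mul_nonneg (by positivity) hH
  set F := ⨆ s : V, (1 / 2 : ℝ) * ∑ i, ∑ j, |f s i j| with hFdef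
  have hFle : ∀ s, (1 / 2 : ℝ) * ∑ i, ∑ j, |f s i j| ≤ F := fun s =>
    le_ciSup (f := fun s : V => (1 / 2 : ℝ) * ∑ i, ∑ j, |f s i j|) (Set.finite_range _).bddAbove s
  have hF0 : 0 ≤ F := Real.iSup_nonneg fun s => by positivity
  have hk1 : (1 : ℝ) ≤ cfg.kappa := by
    exact_mod_cast (cfg.ratio_pos x0).trans (cfg.kappa_ge x0)
  have hD1 : (1 : ℝ) ≤ G.maxDegree := by
    exact_mod_cast (Nat.succ_le_of_lt (cfg.degree_pos x0)).trans (G.degree_le_maxDegree x0)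
  have hn1 : (1 : ℝ) ≤ Fintype.card V := by
    exact_mod_cast Nat.succ_le_of_lt (Fintype.card_pos_iff.mpr ⟨x0⟩)
  have hprod : (1 : ℝ) ≤ (G.maxDegree : ℝ) * (Fintype.card V : ℝ) * (cfg.kappa : ℝ) :=
    one_le_mul_of_one_le_of_one_le (one_le_mul_of_one_le_of_one_le hD1 hn1) hk1
  set X : ℝ := (G.maxDegree : ℝ) * (Fintype.card V * cfg.kappa + 3 * cfg.kappa * F) with hX
  have hX0 : 0 ≤ X := by positivity
  refine ⟨⌊X⌋₊ + 1, ?_, ?_⟩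
  · have h1 : (⌊X⌋₊ : ℝ) ≤ X := Nat.floor_le hX0
    push_cast
    have h2 : X = (G.maxDegree : ℝ) * (Fintype.card V : ℝ) * (cfg.kappa : ℝ)
        + 3 * ((cfg.kappa : ℝ) * (G.maxDegree : ℝ) * F) := by rw [hX]; ring
    linarith
  · intro u v huv
    have hvis : cfg.d u ≤ cfg.visits x0 (⌊X⌋₊ + 1) u := by
      by_contra hc
      push Not at hc
      have h1 := cfg.main_bound x0 hG (hf u) _ hc
      have h2 : (G.maxDegree : ℝ) * (Fintype.card V * cfg.kappa
          + 3 * cfg.kappa * ((1 / 2 : ℝ) * ∑ i, ∑ j, |f u i j|)) ≤ X := by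
        have := hFle u
        rw [hX]
        gcongr
      have h3 := Nat.lt_floor_add_one X
      push_cast at h1
      linarith
    obtain ⟨l, h1, h2, h3⟩ := cfg.trav_pos x0 _ (cfg.trav_pos_of_visits x0 _ huv hvis)
    exact ⟨l, h1, h2, Or.inl h3⟩
end
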